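/- Helmholtz–Kirchhoff identity in two dimensions: for fixed y, z ∈ ℝ² and k > 0, ∫_{∂B_R} conj(Γ^k(x,y)) Γ^k(x,z) dσ(x) → -(1/k) Im Γ^k(y,z) as R → ∞, where Γ^k(x,y) = -(i/4) H_0^{(1)}(k|x-y|). -/

import Mathlib

open MeasureTheory Filter Complex
open scoped Real BigOperators Topology

noncomputable section

/-- Bessel function of the first kind, order 0 (power series). -/
def besselJ0 (x : ℝ) : ℝ :=
  ∑' m : ℕ, (-1 : ℝ) ^ m / ((m.factorial : ℝ) ^ 2) * (x / 2) ^ (2 * m)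

/-- Bessel function of the first kind, order 1 (power series). -/
def besselJ1 (x : ℝ) : ℝ :=
  ∑' m : ℕ, (-1 : ℝ) ^ m / ((m.factorial : ℝ) * ((m + 1).factorial : ℝ)) * (x / 2) ^ (2 * m + 1)

/-- Bessel function of the second kind, order 0. -/
def besselY0 (x : ℝ) : ℝ :=
  (2 / Real.pi) * ((Real.log (x / 2) + Real.eulerMascheroniConstant) * besselJ0 x
    + ∑' m : ℕ, (-1 : ℝ) ^ m * ((harmonic (m + 1) : ℝ)) /
        (((m + 1).factorial : ℝ) ^ 2) * (x / 2) ^ (2 * (m + 1)))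

/-- Hankel function of the first kind, order 0: `H₀⁽¹⁾ = J₀ + i Y₀`. -/
def hankelH10 (x : ℝ) : ℂ := (besselJ0 x : ℂ) + Complex.I * (besselY0 x : ℂ)

/-- Outgoing fundamental solution `Γ^k(x) = -(i/4) H₀⁽¹⁾(k|x|)` of the 2D Helmholtz operator. -/
def gammaK (k : ℝ) (x : EuclideanSpace ℝ (Fin 2)) : ℂ :=
  -(Complex.I / 4) * hankelH10 (k * ‖x‖)

/-- Laplacian on `ℝ²`, as the sum of second directional derivatives along the
coordinate directions. -/
def lapl {F : Type*} [NormedAddCommGroup F] [NormedSpace ℝ F]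
    (f : EuclideanSpace ℝ (Fin 2) → F) (x : EuclideanSpace ℝ (Fin 2)) : F :=
  ∑ i : Fin 2, iteratedDeriv 2 (fun t : ℝ => f (x + t • EuclideanSpace.single i (1 : ℝ))) 0

/-- The point at angle `θ` on the circle of radius `R` centred at the origin of `ℝ²`. -/
def circlePt (R θ : ℝ) : EuclideanSpace ℝ (Fin 2) :=
  (EuclideanSpace.equiv (Fin 2) ℝ).symm ![R * Real.cos θ, R * Real.sin θ]


/-- Entire power series with coefficients `a`. -/
def pser (a : ℕ → ℝ) (t : ℝ) : ℝ := ∑' n : ℕ, a n * t ^ n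

/-- Coefficients of the derivative series. -/
def dco (a : ℕ → ℝ) (n : ℕ) : ℝ := (n + 1 : ℝ) * a (n + 1)

/-- Factorially bounded coefficients. -/
def Fbd (a : ℕ → ℝ) : Prop := ∀ n, |a n| ≤ 1 / (n.factorial : ℝ)

lemma Fbd.dco {a : ℕ → ℝ} (h : Fbd a) : Fbd (dco a) := by
  intro n
  unfold _root_.dco
  have h1 := h (n + 1)
  have hn : (0 : ℝ) < (n : ℝ) + 1 := by positivity
  rw [abs_mul, abs_of_pos hn]
  rw [Nat.factorial_succ] at h1
  push_cast at h1
  calc ((n : ℝ) + 1) * |a (n + 1)| ≤ ((n : ℝ) + 1) * (1 / (((n : ℝ) + 1) * n.factorial)) := by gcongr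
    _ = 1 / (n.factorial : ℝ) := by field_simp

lemma Fbd.summable {a : ℕ → ℝ} (h : Fbd a) (t : ℝ) : Summable (fun n => a n * t ^ n) := by
  refine Summable.of_norm_bounded (Real.summable_pow_div_factorial |t|) (fun n => ?_)
  rw [Real.norm_eq_abs, abs_mul, abs_pow]
  calc |a n| * |t| ^ n ≤ 1 / (n.factorial : ℝ) * |t| ^ n := by gcongr; exact h n
    _ = _ := by ring

lemma Fbd.hasDerivAt {a : ℕ → ℝ} (h : Fbd a) (t : ℝ) :
    HasDerivAt (pser a) (pser (_root_.dco a) t) t := by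
  have hs : pser a = fun t => a 0 + ∑' n : ℕ, a (n + 1) * t ^ (n + 1) := by
    funext t
    unfold pser
    rw [(h.summable t).tsum_eq_zero_add]; simp
  rw [hs]
  unfold pser
  refine HasDerivAt.const_add _ ?_
  set B : ℝ := |t| + 1
  refine hasDerivAt_tsum_of_isPreconnected (u := fun n => B ^ n / (n.factorial : ℝ))
    (t := Metric.ball 0 B) (y₀ := 0) (g := fun n t => a (n + 1) * t ^ (n + 1))
    (g' := fun n t => _root_.dco a n * t ^ n)
    (Real.summable_pow_div_factorial B) Metric.isOpen_ball
    (convex_ball _ _).isPreconnected ?_ ?_ ?_ ?_ ?_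
  · intro n y _
    have := (hasDerivAt_pow (n + 1) y).const_mul (a (n + 1))
    refine this.congr_deriv ?_
    simp only [_root_.dco, Nat.add_sub_cancel]; push_cast; ring
  · intro n y hy
    have hy' : |y| ≤ B := by simpa using (mem_ball_zero_iff.1 hy).le
    rw [Real.norm_eq_abs, abs_mul, abs_pow]
    calc |_root_.dco a n| * |y| ^ n ≤ 1 / (n.factorial : ℝ) * B ^ n := by
          gcongr; exact h.dco n
      _ = _ := by ring
  · simp [B]; positivity
  · simp
  · simp [B]

lemma Fbd.mul_dco {a : ℕ → ℝ} (h : Fbd a) (t : ℝ) :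
    t * pser (_root_.dco a) t = ∑' n : ℕ, (n : ℝ) * a n * t ^ n := by
  have hs : Summable (fun n : ℕ => (n : ℝ) * a n * t ^ n) := by
    rw [← summable_nat_add_iff 1]
    have := (h.dco.summable t).mul_left t
    refine this.congr (fun n => ?_)
    unfold _root_.dco; push_cast; ring
  rw [hs.tsum_eq_zero_add]
  unfold pser
  rw [← tsum_mul_left]
  simp only [Nat.cast_zero, zero_mul, zero_add]
  refine tsum_congr (fun n => ?_)
  unfold _root_.dco; push_cast; ring

/-- Coefficients of `J₀` in the variable `t = x²/4`. -/
def fco (n : ℕ) : ℝ := (-1) ^ n / ((n.factorial : ℝ) ^ 2)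

/-- Coefficients of the regular part of `Y₀`. -/
def hco (n : ℕ) : ℝ := -(-1) ^ n * (harmonic n : ℝ) / ((n.factorial : ℝ) ^ 2)

lemma fco_fbd : Fbd fco := by
  intro n
  unfold fco
  have : (1 : ℝ) ≤ n.factorial := by exact_mod_cast Nat.one_le_iff_ne_zero.2 n.factorial_ne_zero
  rw [abs_div, abs_pow, abs_neg, abs_one, one_pow, abs_of_nonneg (by positivity)]
  apply one_div_le_one_div_of_le (by positivity)
  nlinarith

lemma harmonic_le_nat (n : ℕ) : harmonic n ≤ n := by
  induction n with
  | zero => simp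
  | succ k ih =>
    rw [harmonic_succ]
    have : ((k + 1 : ℕ) : ℚ)⁻¹ ≤ 1 := by
      apply inv_le_one_of_one_le₀; push_cast; linarith [(Nat.cast_nonneg k : (0:ℚ) ≤ k)]
    push_cast at *
    linarith

lemma harmonic_nonneg' (n : ℕ) : 0 ≤ harmonic n := by
  unfold harmonic; positivity

lemma hco_fbd : Fbd hco := by
  intro n
  unfold hco
  have h0 : (0 : ℝ) < n.factorial := by exact_mod_cast n.factorial_pos
  have h1 : (n : ℝ) ≤ n.factorial := by exact_mod_cast n.self_le_factorial
  have h2 : (harmonic n : ℝ) ≤ n := by exact_mod_cast harmonic_le_nat n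
  have h3 : (0 : ℝ) ≤ harmonic n := by exact_mod_cast harmonic_nonneg' n
  rw [abs_div, abs_mul, abs_neg, abs_pow, abs_neg, abs_one, one_pow, one_mul, abs_of_nonneg h3,
    abs_of_nonneg (by positivity : (0:ℝ) ≤ (n.factorial : ℝ)^2), div_le_div_iff₀ (by positivity) h0]
  nlinarith

/-- `f`, with `J₀(x) = f(x²/4)`. -/
def ff (t : ℝ) : ℝ := pser fco t
def ff1 (t : ℝ) : ℝ := pser (dco fco) t
def ff2 (t : ℝ) : ℝ := pser (dco (dco fco)) t
def hh (t : ℝ) : ℝ := pser hco t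
def hh1 (t : ℝ) : ℝ := pser (dco hco) t
def hh2 (t : ℝ) : ℝ := pser (dco (dco hco)) t

lemma ff_deriv (t : ℝ) : HasDerivAt ff (ff1 t) t := fco_fbd.hasDerivAt t
lemma ff1_deriv (t : ℝ) : HasDerivAt ff1 (ff2 t) t := fco_fbd.dco.hasDerivAt t
lemma hh_deriv (t : ℝ) : HasDerivAt hh (hh1 t) t := hco_fbd.hasDerivAt t
lemma hh1_deriv (t : ℝ) : HasDerivAt hh1 (hh2 t) t := hco_fbd.dco.hasDerivAt t

lemma pser_zero (a : ℕ → ℝ) : pser a 0 = a 0 := by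
  unfold pser
  rw [tsum_eq_single 0]
  · simp
  · intro n hn; simp [hn]

lemma ff_zero : ff 0 = 1 := by unfold ff; rw [pser_zero]; simp [fco]
lemma hh_zero : hh 0 = 0 := by unfold hh; rw [pser_zero]; simp [hco]

lemma Fbd.summable_nat_mul {a : ℕ → ℝ} (h : Fbd a) (t : ℝ) :
    Summable (fun n : ℕ => (n : ℝ) * a n * t ^ n) := by
  rw [← summable_nat_add_iff 1]
  have := (h.dco.summable t).mul_left t
  refine this.congr (fun n => ?_)
  unfold _root_.dco; push_cast; ring

lemma ff_ode (t : ℝ) : t * ff2 t + ff1 t + ff t = 0 := by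
  unfold ff2 ff1 ff
  rw [fco_fbd.dco.mul_dco]
  unfold pser
  rw [← (fco_fbd.dco.summable_nat_mul t).tsum_add (fco_fbd.dco.summable t),
    ← ((fco_fbd.dco.summable_nat_mul t).add (fco_fbd.dco.summable t)).tsum_add (fco_fbd.summable t)]
  convert tsum_zero with n
  have h0 : (n.factorial : ℝ) ≠ 0 := by exact_mod_cast n.factorial_ne_zero
  have h1 : (n : ℝ) + 1 ≠ 0 := by positivity
  unfold dco fco
  rw [Nat.factorial_succ]; push_cast
  field_simp
  ring

lemma hh_ode (t : ℝ) : t * hh2 t + hh1 t + hh t = - ff1 t := by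
  unfold hh2 hh1 hh ff1
  rw [hco_fbd.dco.mul_dco, eq_neg_iff_add_eq_zero]
  unfold pser
  rw [← (hco_fbd.dco.summable_nat_mul t).tsum_add (hco_fbd.dco.summable t),
    ← ((hco_fbd.dco.summable_nat_mul t).add (hco_fbd.dco.summable t)).tsum_add (hco_fbd.summable t),
    ← (((hco_fbd.dco.summable_nat_mul t).add (hco_fbd.dco.summable t)).add
      (hco_fbd.summable t)).tsum_add (fco_fbd.dco.summable t)]
  convert tsum_zero with n
  have h0 : (n.factorial : ℝ) ≠ 0 := by exact_mod_cast n.factorial_ne_zero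
  have h1 : (n : ℝ) + 1 ≠ 0 := by positivity
  unfold dco fco hco
  rw [Nat.factorial_succ, harmonic_succ]; push_cast
  field_simp
  ring

lemma besselJ0_eq (x : ℝ) : besselJ0 x = ff (x ^ 2 / 4) := by
  unfold besselJ0 ff pser fco
  refine tsum_congr (fun n => ?_)
  rw [pow_mul]; congr 2; ring

lemma besselY0_eq (x : ℝ) : besselY0 x = (2 / Real.pi) *
    ((Real.log (x / 2) + Real.eulerMascheroniConstant) * ff (x ^ 2 / 4) + hh (x ^ 2 / 4)) := by
  unfold besselY0
  rw [besselJ0_eq]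
  congr 2
  unfold hh pser
  rw [(hco_fbd.summable _).tsum_eq_zero_add]
  simp only [hco, harmonic_zero]
  simp only [Rat.cast_zero, mul_zero, zero_div, zero_mul, zero_add]
  refine tsum_congr (fun n => ?_)
  rw [pow_mul]
  have : (x / 2) ^ 2 = x ^ 2 / 4 := by ring
  rw [this, pow_succ (-1 : ℝ)]
  ring

/-- Uniqueness for the Bessel equation, real case. -/
lemma bessel_unique_real (u p : ℝ → ℝ)
    (hu : ∀ r, 0 < r → HasDerivAt u (p r / r) r)
    (hp : ∀ r, 0 < r → HasDerivAt p (-(r * u r)) r)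
    (hu0 : Tendsto u (𝓝[>] 0) (𝓝 0)) (hp0 : Tendsto p (𝓝[>] 0) (𝓝 0)) :
    ∀ r, 0 < r → u r = 0 := by
  -- the energy is nonincreasing
  set E : ℝ → ℝ := fun r => u r ^ 2 + (p r / r) ^ 2 with hE
  have hEd : ∀ r, 0 < r → HasDerivAt E (-(2 * (p r) ^ 2 / r ^ 3)) r := by
    intro r hr
    have h1 := (hu r hr).pow 2
    have h2 := (((hp r hr).div (hasDerivAt_id r) hr.ne')).pow 2
    refine (h1.add h2).congr_deriv ?_
    simp only [id, Pi.div_apply, show (2 - 1 : ℕ) = 1 from rfl, pow_one]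
    field_simp
    ring
  have hanti : AntitoneOn E (Set.Ioi 0) := by
    refine antitoneOn_of_deriv_nonpos (convex_Ioi 0) ?_ ?_ ?_
    · intro r hr; exact (hEd r hr).continuousAt.continuousWithinAt
    · rw [interior_Ioi]; intro r hr; exact (hEd r hr).differentiableAt.differentiableWithinAt
    · rw [interior_Ioi]; intro r hr
      rw [(hEd r hr).deriv]
      have : (0:ℝ) < r := hr
      have : 0 ≤ 2 * (p r) ^ 2 / r ^ 3 := by positivity
      linarith
  intro r₀ hr₀
  have key : ∀ ε, 0 < ε → E r₀ ≤ 2 * ε ^ 2 := by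
    intro ε hε
    have h1 : ∀ᶠ r in 𝓝[>] (0:ℝ), |u r| ≤ ε := by
      have := hu0.eventually (Metric.closedBall_mem_nhds (0:ℝ) hε)
      filter_upwards [this] with r hr
      simpa using hr
    obtain ⟨δ, hδ, hδ'⟩ := mem_nhdsGT_iff_exists_Ioo_subset.1 h1
    have hδ0 : (0:ℝ) < δ := hδ
    set s := min (min (δ / 2) 1) r₀ with hs
    have hs0 : 0 < s := by positivity
    have hsδ : s < δ := by
      have : s ≤ δ / 2 := (min_le_left _ _).trans (min_le_left _ _)
      linarith
    have hs1 : s ≤ 1 := (min_le_left _ _).trans (min_le_right _ _)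
    have hsr : s ≤ r₀ := min_le_right _ _
    have hps : |p s| ≤ ε * s := by
      have h2 : ∀ᶠ a in 𝓝[>] (0:ℝ), |p s - p a| ≤ ε * s := by
        have : Set.Ioo 0 s ∈ 𝓝[>] (0:ℝ) := Ioo_mem_nhdsGT hs0
        filter_upwards [this] with a ha
        have h3 := (convex_Icc a s).norm_image_sub_le_of_norm_hasDerivWithin_le (f := p)
          (f' := fun r => -(r * u r)) (C := ε) (x := a) (y := s)
          (fun x hx => (hp x (ha.1.trans_le hx.1)).hasDerivWithinAt) (fun x hx => ?_)
          (Set.left_mem_Icc.2 ha.2.le) (Set.right_mem_Icc.2 ha.2.le)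
        · rw [Real.norm_eq_abs, Real.norm_eq_abs, abs_of_nonneg (by linarith [ha.2] : 0 ≤ s - a)] at h3
          refine h3.trans ?_
          have := ha.1
          gcongr
          linarith
        · have hx0 : 0 < x := ha.1.trans_le hx.1
          have hux : |u x| ≤ ε := hδ' ⟨hx0, hx.2.trans_lt hsδ⟩
          rw [Real.norm_eq_abs, abs_neg, abs_mul, abs_of_pos hx0]
          have : x ≤ 1 := hx.2.trans hs1
          nlinarith [abs_nonneg (u x)]
      have h4 : Tendsto (fun a => |p s - p a|) (𝓝[>] 0) (𝓝 |p s - 0|) :=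
        (tendsto_const_nhds.sub hp0).abs
      have := le_of_tendsto h4 h2
      simpa using this
    have hEs : E s ≤ 2 * ε ^ 2 := by
      have hus : |u s| ≤ ε := hδ' ⟨hs0, hsδ⟩
      have hq : |p s / s| ≤ ε := by
        rw [abs_div, abs_of_pos hs0, div_le_iff₀ hs0]; exact hps
      have a1 : u s ^ 2 ≤ ε ^ 2 := by rw [← sq_abs]; gcongr
      have a2 : (p s / s) ^ 2 ≤ ε ^ 2 := by rw [← sq_abs]; gcongr
      simp only [hE]; linarith
    exact (hanti (Set.mem_Ioi.2 hs0) (Set.mem_Ioi.2 hr₀) hsr).trans hEs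
  have hE0 : E r₀ ≤ 0 := by
    have h5 : Tendsto (fun ε : ℝ => 2 * ε ^ 2) (𝓝[>] 0) (𝓝 0) := by
      have : Tendsto (fun ε : ℝ => 2 * ε ^ 2) (𝓝 0) (𝓝 (2 * 0 ^ 2)) := by
        apply Continuous.tendsto; fun_prop
      simp only [ne_eq, OfNat.ofNat_ne_zero, not_false_eq_true, zero_pow, mul_zero] at this
      exact this.mono_left nhdsWithin_le_nhds
    exact ge_of_tendsto h5 (eventually_nhdsWithin_of_forall key)
  have : u r₀ ^ 2 ≤ 0 := by
    have := sq_nonneg (p r₀ / r₀)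
    simp only [hE] at hE0; linarith
  exact pow_eq_zero_iff (two_ne_zero) |>.1 (le_antisymm this (sq_nonneg _))

lemma hasDerivAt_re' {f : ℝ → ℂ} {f' : ℂ} {x : ℝ} (h : HasDerivAt f f' x) :
    HasDerivAt (fun t => (f t).re) f'.re x :=
  (Complex.reCLM.hasFDerivAt.comp_hasDerivAt x h)

lemma hasDerivAt_im' {f : ℝ → ℂ} {f' : ℂ} {x : ℝ} (h : HasDerivAt f f' x) :
    HasDerivAt (fun t => (f t).im) f'.im x :=
  (Complex.imCLM.hasFDerivAt.comp_hasDerivAt x h)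

/-- Uniqueness for the Bessel equation, complex case. -/
lemma bessel_unique (u p : ℝ → ℂ)
    (hu : ∀ r, 0 < r → HasDerivAt u (p r / r) r)
    (hp : ∀ r, 0 < r → HasDerivAt p (-(r * u r)) r)
    (hu0 : Tendsto u (𝓝[>] 0) (𝓝 0)) (hp0 : Tendsto p (𝓝[>] 0) (𝓝 0)) :
    ∀ r, 0 < r → u r = 0 := by
  intro r hr
  apply Complex.ext
  · refine bessel_unique_real (fun t => (u t).re) (fun t => (p t).re) ?_ ?_ ?_ ?_ r hr
    · intro t ht; refine (hasDerivAt_re' (hu t ht)).congr_deriv ?_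
      rw [Complex.div_ofReal_re]
    · intro t ht; refine (hasDerivAt_re' (hp t ht)).congr_deriv ?_
      simp
    · exact (Complex.continuous_re.tendsto 0).comp hu0
    · exact (Complex.continuous_re.tendsto 0).comp hp0
  · refine bessel_unique_real (fun t => (u t).im) (fun t => (p t).im) ?_ ?_ ?_ ?_ r hr
    · intro t ht; refine (hasDerivAt_im' (hu t ht)).congr_deriv ?_
      rw [Complex.div_ofReal_im]
    · intro t ht; refine (hasDerivAt_im' (hp t ht)).congr_deriv ?_
      simp
    · exact (Complex.continuous_im.tendsto 0).comp hu0
    · exact (Complex.continuous_im.tendsto 0).comp hp0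

/-- Companion of the function J₀. -/
def pJ (r : ℝ) : ℝ := r ^ 2 / 2 * ff1 (r ^ 2 / 4)
/-- `(π/2) Y₀`. -/
def uK (r : ℝ) : ℝ :=
  (Real.log (r / 2) + Real.eulerMascheroniConstant) * ff (r ^ 2 / 4) + hh (r ^ 2 / 4)
/-- Companion of `uK`. -/
def pK (r : ℝ) : ℝ := ff (r ^ 2 / 4)
  + (Real.log (r / 2) + Real.eulerMascheroniConstant) * pJ r + r ^ 2 / 2 * hh1 (r ^ 2 / 4)

lemma sq4_deriv (r : ℝ) : HasDerivAt (fun r : ℝ => r ^ 2 / 4) (r / 2) r := by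
  refine ((hasDerivAt_pow 2 r).div_const 4).congr_deriv ?_
  simp; ring

lemma sq2_deriv (r : ℝ) : HasDerivAt (fun r : ℝ => r ^ 2 / 2) r r := by
  refine ((hasDerivAt_pow 2 r).div_const 2).congr_deriv ?_
  simp

lemma log_half_deriv {r : ℝ} (hr : 0 < r) :
    HasDerivAt (fun r : ℝ => Real.log (r / 2) + Real.eulerMascheroniConstant) (1 / r) r := by
  refine ((((hasDerivAt_id r).div_const 2).log (by simp; positivity)).add_const _).congr_deriv ?_
  simp; field_simp

lemma J0_deriv {r : ℝ} (hr : 0 < r) : HasDerivAt besselJ0 (pJ r / r) r := by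
  have : besselJ0 = fun r => ff (r ^ 2 / 4) := funext besselJ0_eq
  rw [this]
  refine ((ff_deriv (r ^ 2 / 4)).comp r (sq4_deriv r)).congr_deriv ?_
  unfold pJ; field_simp

lemma pJ_deriv (r : ℝ) : HasDerivAt pJ (-(r * besselJ0 r)) r := by
  refine ((sq2_deriv r).mul ((ff1_deriv (r ^ 2 / 4)).comp r (sq4_deriv r))).congr_deriv ?_
  rw [besselJ0_eq]
  have := ff_ode (r ^ 2 / 4)
  simp only [Function.comp]
  rw [show pser (dco fco) (r ^ 2 / 4) = ff1 (r ^ 2 / 4) from rfl]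
  linear_combination r * this

lemma uK_deriv {r : ℝ} (hr : 0 < r) : HasDerivAt uK (pK r / r) r := by
  refine (((log_half_deriv hr).mul ((ff_deriv (r ^ 2 / 4)).comp r (sq4_deriv r))).add
    ((hh_deriv (r ^ 2 / 4)).comp r (sq4_deriv r))).congr_deriv ?_
  unfold pK pJ; simp only [Function.comp]; field_simp

lemma pK_deriv {r : ℝ} (hr : 0 < r) : HasDerivAt pK (-(r * uK r)) r := by
  refine ((((ff_deriv (r ^ 2 / 4)).comp r (sq4_deriv r)).add
    ((log_half_deriv hr).mul (pJ_deriv r))).add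
    ((sq2_deriv r).mul ((hh1_deriv (r ^ 2 / 4)).comp r (sq4_deriv r)))).congr_deriv ?_
  have h1 := hh_ode (r ^ 2 / 4)
  simp only [Function.comp, uK, pJ, besselJ0_eq]
  rw [show pser (dco hco) (r ^ 2 / 4) = hh1 (r ^ 2 / 4) from rfl]
  field_simp
  linear_combination 4 * h1

lemma continuous_ff : Continuous ff :=
  continuous_iff_continuousAt.2 fun t => (ff_deriv t).continuousAt
lemma continuous_ff1 : Continuous ff1 :=
  continuous_iff_continuousAt.2 fun t => (ff1_deriv t).continuousAt
lemma continuous_hh : Continuous hh :=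
  continuous_iff_continuousAt.2 fun t => (hh_deriv t).continuousAt
lemma continuous_hh1 : Continuous hh1 :=
  continuous_iff_continuousAt.2 fun t => (hh1_deriv t).continuousAt

lemma tend_comp {f : ℝ → ℝ} (hf : Continuous f) : Tendsto (fun r : ℝ => f (r ^ 2 / 4))
    (𝓝[>] 0) (𝓝 (f 0)) := by
  have : Continuous (fun r : ℝ => f (r ^ 2 / 4)) := by fun_prop
  have h := this.tendsto 0
  simp only [ne_eq, OfNat.ofNat_ne_zero, not_false_eq_true, zero_pow, zero_div] at h
  exact h.mono_left nhdsWithin_le_nhds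

lemma J0_tend : Tendsto besselJ0 (𝓝[>] 0) (𝓝 1) := by
  have : besselJ0 = fun r => ff (r ^ 2 / 4) := funext besselJ0_eq
  rw [this, ← ff_zero]; exact tend_comp continuous_ff

lemma id_tend0 : Tendsto (fun r : ℝ => r) (𝓝[>] 0) (𝓝 0) := nhdsWithin_le_nhds

lemma pJ_tend : Tendsto pJ (𝓝[>] 0) (𝓝 0) := by
  have h := (((id_tend0).pow 2).div_const 2).mul (tend_comp continuous_ff1)
  have h' : Tendsto (fun r : ℝ => r ^ 2 / 2 * ff1 (r ^ 2 / 4)) (𝓝[>] 0) (𝓝 0) := by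
    simpa using h
  exact h'

lemma r_log_tend : Tendsto (fun r : ℝ => r * (Real.log (r / 2) + Real.eulerMascheroniConstant))
    (𝓝[>] 0) (𝓝 0) := by
  have h1 : Tendsto (fun r : ℝ => r * Real.log r) (𝓝[>] 0) (𝓝 0) := by
    have := Real.continuous_mul_log.tendsto 0
    simp only [Real.log_zero, mul_zero] at this
    exact this.mono_left nhdsWithin_le_nhds
  have h2 := h1.add (id_tend0.mul_const (Real.eulerMascheroniConstant - Real.log 2))
  simp only [zero_mul, add_zero] at h2
  refine h2.congr' ?_
  filter_upwards [self_mem_nhdsWithin] with r hr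
  rw [Real.log_div (ne_of_gt hr) two_ne_zero]; ring

lemma pK_tend : Tendsto pK (𝓝[>] 0) (𝓝 1) := by
  have h1 := tend_comp continuous_ff
  have h2 := ((r_log_tend.mul id_tend0).div_const 2).mul (tend_comp continuous_ff1)
  have h3 := (((id_tend0).pow 2).div_const 2).mul (tend_comp continuous_hh1)
  have h := (h1.add h2).add h3
  rw [ff_zero] at h
  simp only [mul_zero, zero_div, zero_mul, ne_eq, OfNat.ofNat_ne_zero, not_false_eq_true, zero_pow, add_zero] at h
  refine h.congr (fun r => ?_)
  unfold pK pJ; ring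

lemma uK_tend : Tendsto (fun r => uK r - (Real.log (r / 2) + Real.eulerMascheroniConstant))
    (𝓝[>] 0) (𝓝 0) := by
  -- (f(t) - 1) / r → 0
  have hd : Tendsto (fun r : ℝ => (ff (r ^ 2 / 4) - 1) / r) (𝓝[>] 0) (𝓝 0) := by
    have hder := ((ff_deriv (0 ^ 2 / 4)).comp (0:ℝ) (sq4_deriv 0))
    have := hder.tendsto_slope_zero_right
    simp only [zero_div, mul_zero] at this
    refine this.congr (fun r => ?_)
    simp [ff_zero, div_eq_inv_mul]
  have h := (r_log_tend.mul hd).add (tend_comp continuous_hh)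
  rw [hh_zero] at h
  simp only [mul_zero, add_zero] at h
  refine h.congr' ?_
  filter_upwards [self_mem_nhdsWithin] with r hr
  have : r ≠ 0 := ne_of_gt hr
  unfold uK; field_simp; ring

/-- `√(w² - 2ir)`. -/
def QQ (r w : ℝ) : ℂ := ((w : ℂ) ^ 2 - 2 * r * Complex.I) ^ (2⁻¹ : ℂ)

lemma QQ_base_re (r w : ℝ) : ((w : ℂ) ^ 2 - 2 * r * Complex.I).re = w ^ 2 := by
  have : ((w : ℂ) ^ 2 - 2 * r * Complex.I) = ((w ^ 2 : ℝ) : ℂ) + ((-(2 * r) : ℝ) : ℂ) * Complex.I := by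
    push_cast; ring
  rw [this]; simp [-ofReal_pow]

lemma QQ_base_im (r w : ℝ) : ((w : ℂ) ^ 2 - 2 * r * Complex.I).im = -(2 * r) := by
  have : ((w : ℂ) ^ 2 - 2 * r * Complex.I) = ((w ^ 2 : ℝ) : ℂ) + ((-(2 * r) : ℝ) : ℂ) * Complex.I := by
    push_cast; ring
  rw [this]; simp [-ofReal_pow]

lemma QQ_slit {r : ℝ} (hr : 0 < r) (w : ℝ) :
    ((w : ℂ) ^ 2 - 2 * r * Complex.I) ∈ Complex.slitPlane := by
  right; rw [QQ_base_im]; intro h0; linarith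

lemma QQ_sq (r w : ℝ) : QQ r w ^ 2 = (w : ℂ) ^ 2 - 2 * r * Complex.I := by
  unfold QQ
  have := Complex.cpow_nat_inv_pow ((w : ℂ) ^ 2 - 2 * r * Complex.I) (n := 2) two_ne_zero
  simp

lemma QQ_norm_sq (r w : ℝ) : ‖QQ r w‖ ^ 2 = ‖(w : ℂ) ^ 2 - 2 * r * Complex.I‖ := by
  rw [← norm_pow, QQ_sq]

lemma QQ_norm_ge (r w : ℝ) : |w| ≤ ‖QQ r w‖ := by
  refine abs_le_of_sq_le_sq ?_ (norm_nonneg _)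
  rw [QQ_norm_sq]
  calc w ^ 2 = ((w : ℂ) ^ 2 - 2 * r * Complex.I).re := (QQ_base_re r w).symm
    _ ≤ _ := Complex.re_le_norm _

lemma QQ_norm_sq_ge {r : ℝ} (hr : 0 < r) (w : ℝ) : 2 * r ≤ ‖QQ r w‖ ^ 2 := by
  rw [QQ_norm_sq]
  have := Complex.abs_im_le_norm ((w : ℂ) ^ 2 - 2 * r * Complex.I)
  rw [QQ_base_im, abs_neg, abs_of_pos (by positivity)] at this
  exact this

lemma QQ_norm_le {r : ℝ} (hr : 0 < r) (w : ℝ) : ‖QQ r w‖ ≤ 1 + w ^ 2 + 2 * r := by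
  have h : ‖QQ r w‖ ^ 2 ≤ w ^ 2 + 2 * r := by
    rw [QQ_norm_sq]
    refine (norm_sub_le _ _).trans ?_
    simp [abs_of_pos hr]
  nlinarith [sq_nonneg (‖QQ r w‖ - 1), sq_nonneg w, norm_nonneg (QQ r w)]

lemma QQ_one_ge (w : ℝ) : 1 ≤ ‖QQ 1 w‖ := by
  have := QQ_norm_sq_ge one_pos w
  nlinarith [norm_nonneg (QQ 1 w)]

lemma QQ_re_pos {r : ℝ} (hr : 0 < r) (w : ℝ) : 0 < (QQ r w).re := by
  unfold QQ
  rw [Complex.cpow_inv_two_re, QQ_base_re]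
  apply Real.sqrt_pos.2
  have : 0 < ‖(w : ℂ) ^ 2 - 2 * r * Complex.I‖ :=
    norm_pos_iff.2 (Complex.slitPlane_ne_zero (QQ_slit hr w))
  positivity

lemma QQ_ne_zero {r : ℝ} (hr : 0 < r) (w : ℝ) : QQ r w ≠ 0 := by
  intro h
  have := QQ_re_pos hr w
  rw [h] at this; simp at this

lemma QQ_scale {r : ℝ} (hr : 0 < r) (v : ℝ) : QQ r (√r * v) = √r * QQ 1 v := by
  have h2 : QQ r (√r * v) ^ 2 = (√r * QQ 1 v) ^ 2 := by
    rw [QQ_sq, mul_pow, QQ_sq]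
    have : ((√r : ℝ) : ℂ) ^ 2 = r := by
      rw [← Complex.ofReal_pow, Real.sq_sqrt hr.le]
    push_cast
    rw [mul_pow, this]; ring
  rcases sq_eq_sq_iff_eq_or_eq_neg.1 h2 with h | h
  · exact h
  · exfalso
    have h1 := QQ_re_pos hr (√r * v)
    have h3 := QQ_re_pos one_pos v
    rw [h, Complex.neg_re, Complex.re_ofReal_mul] at h1
    have := mul_pos (Real.sqrt_pos.2 hr) h3
    linarith

lemma QQ_deriv {r : ℝ} (hr : 0 < r) (w : ℝ) : HasDerivAt (QQ r) (w / QQ r w) w := by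
  have h1 : HasDerivAt (fun z : ℂ => z ^ 2 - 2 * r * Complex.I) (2 * (w : ℂ)) (w : ℂ) := by
    refine ((hasDerivAt_pow 2 (w : ℂ)).sub_const _).congr_deriv ?_
    simp
  have h2 := (h1.cpow_const (c := (2⁻¹ : ℂ)) (QQ_slit hr w)).comp_ofReal
  refine h2.congr_deriv ?_
  have hne := QQ_ne_zero hr w
  rw [Complex.cpow_sub _ _ (Complex.slitPlane_ne_zero (QQ_slit hr w)), Complex.cpow_one, ← QQ_sq]
  have : (QQ r w ^ 2) ^ (2⁻¹ : ℂ) = QQ r w := by rw [QQ_sq]; rfl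
  rw [this]; field_simp

lemma QQ_cont {r : ℝ} (hr : 0 < r) : Continuous (QQ r) :=
  continuous_iff_continuousAt.2 fun w => (QQ_deriv hr w).continuousAt

lemma gauss_int (n : ℕ) {b : ℝ} (hb : 0 < b) :
    IntegrableOn (fun v : ℝ => v ^ n * Real.exp (-(b * v ^ 2))) (Set.Ioi 0) := by
  have := (integrableOn_rpow_mul_exp_neg_mul_sq hb (s := n)
    (by have : (0:ℝ) ≤ n := n.cast_nonneg
        linarith))
  refine this.congr_fun (fun v _ => ?_) measurableSet_Ioi
  simp

lemma gauss_intC (n : ℕ) {b : ℝ} (hb : 0 < b) (C : ℝ) {g : ℝ → ℂ} (hg : ContinuousOn g (Set.Ioi 0))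
    (hb' : ∀ v, 0 < v → ‖g v‖ ≤ C * (1 + v ^ n)) :
    IntegrableOn (fun v : ℝ => (Real.exp (-(b * v ^ 2)) : ℂ) * g v) (Set.Ioi 0) := by
  have h1 := ((gauss_int 0 hb).add (gauss_int n hb)).const_mul C
  refine Integrable.mono' h1 ?_ ?_
  · refine ContinuousOn.aestronglyMeasurable ?_ measurableSet_Ioi
    refine ContinuousOn.mul ?_ hg
    exact (Complex.continuous_ofReal.comp (by fun_prop)).continuousOn
  · filter_upwards [ae_restrict_mem measurableSet_Ioi] with v hv
    rw [norm_mul, Complex.norm_real, Real.norm_eq_abs, abs_of_pos (Real.exp_pos _)]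
    have := hb' v hv
    simp only [Pi.add_apply, pow_zero, one_mul]
    have he := Real.exp_pos (-(b * v ^ 2))
    nlinarith

/-- Moments. -/
def MM (n : ℕ) (r : ℝ) : ℂ :=
  ∫ v in Set.Ioi (0:ℝ), (Real.exp (-(r * v ^ 2)) : ℂ) * ((v : ℂ) ^ (2 * n) / QQ 1 v)

lemma mom_cont (n : ℕ) {r : ℝ} (hr : 0 < r) : Continuous (fun v : ℝ => (v : ℂ) ^ (2 * n) / QQ r v) := by
  refine Continuous.div (by fun_prop) (QQ_cont hr) (QQ_ne_zero hr)

lemma mom_le (n : ℕ) (v : ℝ) : ‖(v : ℂ) ^ (2 * n) / QQ 1 v‖ ≤ v ^ (2 * n) := by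
  rw [norm_div, norm_pow, Complex.norm_real, Real.norm_eq_abs, pow_mul, sq_abs, ← pow_mul]
  apply div_le_self _ (QQ_one_ge v)
  rw [pow_mul]; positivity

lemma mom_int (n : ℕ) {r : ℝ} (hr : 0 < r) : IntegrableOn (fun v : ℝ =>
    (Real.exp (-(r * v ^ 2)) : ℂ) * ((v : ℂ) ^ (2 * n) / QQ 1 v)) (Set.Ioi 0) := by
  refine gauss_intC (2 * n) hr 1 (mom_cont n one_pos).continuousOn (fun v _ => ?_)
  refine (mom_le n v).trans ?_
  linarith

lemma MM_deriv (n : ℕ) {r : ℝ} (hr : 0 < r) : HasDerivAt (MM n) (-MM (n + 1) r) r := by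
  have key := hasDerivAt_integral_of_dominated_loc_of_deriv_le (μ := volume.restrict (Set.Ioi (0:ℝ)))
    (F := fun (r : ℝ) (v : ℝ) => (Real.exp (-(r * v ^ 2)) : ℂ) * ((v : ℂ) ^ (2 * n) / QQ 1 v))
    (F' := fun (r : ℝ) (v : ℝ) => -((Real.exp (-(r * v ^ 2)) : ℂ) * ((v : ℂ) ^ (2 * (n + 1)) / QQ 1 v)))
    (x₀ := r) (s := Set.Ioi (r / 2))
    (bound := fun v => v ^ (2 * (n + 1)) * Real.exp (-(r / 2 * v ^ 2)))
    (Ioi_mem_nhds (by linarith)) ?_ ?_ ?_ ?_ ?_ ?_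
  · have h := key.2
    rw [integral_neg] at h
    exact h
  · filter_upwards [Ioi_mem_nhds hr] with x hx
    exact (mom_int n hx).aestronglyMeasurable
  · exact mom_int n hr
  · exact (mom_int (n + 1) hr).aestronglyMeasurable.neg
  · filter_upwards [ae_restrict_mem measurableSet_Ioi] with v hv x hx
    rw [norm_neg, norm_mul, Complex.norm_real, Real.norm_eq_abs, abs_of_pos (Real.exp_pos _), mul_comm]
    have : r / 2 < x := hx
    have h0 : (0:ℝ) < v := hv
    gcongr
    exact mom_le _ _
  · exact gauss_int _ (by positivity)
  · filter_upwards with v x _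
    have h1 : HasDerivAt (fun x : ℝ => Real.exp (-(x * v ^ 2))) (-(v ^ 2) * Real.exp (-(x * v ^ 2))) x := by
      refine (((hasDerivAt_id x).mul_const (v ^ 2)).neg.exp).congr_deriv ?_
      simp; ring
    refine (h1.ofReal_comp.mul_const _).congr_deriv ?_
    push_cast; ring

lemma MM_ode {r : ℝ} (hr : 0 < r) :
    r * MM 2 r - 2 * Complex.I * r * MM 1 r - MM 1 r + Complex.I * MM 0 r = 0 := by
  set f : ℝ → ℂ := fun v => (Real.exp (-(r * v ^ 2)) : ℂ) * (v * QQ 1 v) with hf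
  set f' : ℝ → ℂ := fun v => -2 * (r * ((Real.exp (-(r * v ^ 2)) : ℂ) * ((v : ℂ) ^ (2 * 2) / QQ 1 v))
    - 2 * Complex.I * r * ((Real.exp (-(r * v ^ 2)) : ℂ) * ((v : ℂ) ^ (2 * 1) / QQ 1 v))
    - ((Real.exp (-(r * v ^ 2)) : ℂ) * ((v : ℂ) ^ (2 * 1) / QQ 1 v))
    + Complex.I * ((Real.exp (-(r * v ^ 2)) : ℂ) * ((v : ℂ) ^ (2 * 0) / QQ 1 v))) with hf'
  have hd : ∀ v : ℝ, HasDerivAt f (f' v) v := by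
    intro v
    have h1 : HasDerivAt (fun v : ℝ => Real.exp (-(r * v ^ 2)))
        (-(2 * r * v) * Real.exp (-(r * v ^ 2))) v := by
      refine (((hasDerivAt_pow 2 v).const_mul r).neg.exp).congr_deriv ?_
      simp; ring
    have h2 : HasDerivAt (fun v : ℝ => (v : ℂ)) 1 v := Complex.ofRealCLM.hasDerivAt
    refine (h1.ofReal_comp.mul (h2.mul (QQ_deriv one_pos v))).congr_deriv ?_
    simp only [hf', Pi.mul_apply]
    have hne := QQ_ne_zero one_pos v
    have hsq := QQ_sq 1 v
    push_cast at hsq ⊢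
    field_simp
    ring_nf
    ring_nf at hsq
    rw [hsq]
    ring
  have i2 := (mom_int 2 hr).const_mul (r : ℂ)
  have i1 := (mom_int 1 hr).const_mul (2 * Complex.I * r)
  have i1' := (mom_int 1 hr)
  have i0 := (mom_int 0 hr).const_mul Complex.I
  have hitg' : IntegrableOn f' (Set.Ioi 0) := (((i2.sub i1).sub i1').add i0).const_mul (-2)
  have hitg : IntegrableOn f (Set.Ioi 0) := by
    refine gauss_intC 3 hr 4 (((Complex.continuous_ofReal).mul (QQ_cont one_pos)).continuousOn)
      (fun v hv => ?_)
    rw [norm_mul, Complex.norm_real, Real.norm_eq_abs, abs_of_pos hv]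
    have := QQ_norm_le one_pos v
    have : v * ‖QQ 1 v‖ ≤ v * (3 + v ^ 2) := by gcongr; linarith
    have h3 : v ≤ 1 + v ^ 3 := by
      rcases le_total v 1 with h | h
      · have : 0 ≤ v ^ 3 := by positivity
        linarith
      · nlinarith [mul_le_mul h h zero_le_one hv.le]
    nlinarith
  have hlim := tendsto_zero_of_hasDerivAt_of_integrableOn_Ioi (fun v _ => hd v) hitg' hitg
  have hI := integral_Ioi_of_hasDerivAt_of_tendsto' (fun v _ => hd v) hitg' hlim
  have hI2 : ∫ v in Set.Ioi (0:ℝ), f' v = -2 * (r * MM 2 r - 2 * Complex.I * r * MM 1 r - MM 1 r + Complex.I * MM 0 r) := by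
    simp only [hf']
    have e1 := integral_add ((i2.sub i1).sub i1') i0
    have e2 := integral_sub (i2.sub i1) i1'
    simp only [Pi.sub_apply] at e1 e2
    rw [integral_const_mul, e1, e2,
      integral_sub i2 i1, integral_const_mul, integral_const_mul, integral_const_mul]
    rfl
  rw [hI2] at hI
  simp [hf] at hI
  linear_combination hI

def uG (r : ℝ) : ℂ := Complex.exp (Complex.I * r) * MM 0 r
def pG (r : ℝ) : ℂ := r * Complex.exp (Complex.I * r) * (-MM 1 r + Complex.I * MM 0 r)

lemma expI_deriv (r : ℝ) : HasDerivAt (fun r : ℝ => Complex.exp (Complex.I * r))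
    (Complex.I * Complex.exp (Complex.I * r)) r := by
  have h2 : HasDerivAt (fun v : ℝ => (v : ℂ)) 1 r := Complex.ofRealCLM.hasDerivAt
  refine ((h2.const_mul Complex.I).cexp).congr_deriv ?_
  ring

lemma uG_deriv {r : ℝ} (hr : 0 < r) : HasDerivAt uG (pG r / r) r := by
  refine ((expI_deriv r).mul (MM_deriv 0 hr)).congr_deriv ?_
  have : (r : ℂ) ≠ 0 := by exact_mod_cast hr.ne'
  unfold pG; field_simp; ring

lemma pG_deriv {r : ℝ} (hr : 0 < r) : HasDerivAt pG (-(r * uG r)) r := by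
  have h2 : HasDerivAt (fun v : ℝ => (v : ℂ)) 1 r := Complex.ofRealCLM.hasDerivAt
  refine ((h2.mul (expI_deriv r)).mul ((MM_deriv 1 hr).neg.add
    ((MM_deriv 0 hr).const_mul Complex.I))).congr_deriv ?_
  have := MM_ode hr
  simp only [uG, Pi.add_apply, Pi.neg_apply, Pi.mul_apply]
  linear_combination Complex.exp (Complex.I * r) * this + r * Complex.exp (Complex.I * r) * MM 0 r * Complex.I_sq

/-- Scaled representation. -/
lemma MM_scale (n : ℕ) {r : ℝ} (hr : 0 < r) : (r : ℂ) ^ n * MM n r =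
    ∫ w in Set.Ioi (0:ℝ), (Real.exp (-(1 * w ^ 2)) : ℂ) * ((w : ℂ) ^ (2 * n) / QQ r w) := by
  have hs : 0 < √r := Real.sqrt_pos.2 hr
  have h := integral_comp_mul_left_Ioi
    (fun w : ℝ => (Real.exp (-(1 * w ^ 2)) : ℂ) * ((w : ℂ) ^ (2 * n) / QQ r w)) 0 hs
  rw [mul_zero] at h
  have hs' : ((√r : ℝ) : ℂ) ≠ 0 := by exact_mod_cast hs.ne'
  have hsq : ((√r : ℝ) : ℂ) ^ 2 = r := by
    rw [← Complex.ofReal_pow, Real.sq_sqrt hr.le]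
  have h' : ∀ x : ℝ, (Real.exp (-(1 * (√r * x) ^ 2)) : ℂ) * (((√r * x : ℝ) : ℂ) ^ (2 * n) / QQ r (√r * x))
     = ((√r : ℝ) : ℂ)⁻¹ * ((r : ℂ) ^ n * ((Real.exp (-(r * x ^ 2)) : ℂ) * ((x : ℂ) ^ (2 * n) / QQ 1 x))) := by
    intro x
    rw [QQ_scale hr]
    push_cast
    have e1 : (1 : ℝ) * (√r * x) ^ 2 = r * x ^ 2 := by rw [mul_pow, Real.sq_sqrt hr.le, one_mul]
    have e2 : ((√r : ℝ) * (x : ℂ)) ^ (2 * n) = (r : ℂ) ^ n * (x : ℂ) ^ (2 * n) := by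
      rw [mul_pow, pow_mul, hsq]
    have e3 : (1 : ℂ) * (((√r : ℝ) : ℂ) * x) ^ 2 = r * x ^ 2 := by rw [mul_pow, hsq, one_mul]
    rw [e2, e3]
    have hne := QQ_ne_zero one_pos x
    field_simp
  simp only [h'] at h
  rw [integral_const_mul, integral_const_mul, Complex.real_smul, Complex.ofReal_inv] at h
  exact mul_left_cancel₀ (inv_ne_zero hs') h

lemma QQ_re_ge {r : ℝ} (hr : 0 < r) (w : ℝ) : √r ≤ (QQ r w).re := by
  have h := QQ_norm_sq_ge hr w
  rw [QQ_norm_sq] at h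
  unfold QQ
  rw [Complex.cpow_inv_two_re, QQ_base_re]
  apply Real.sqrt_le_sqrt
  nlinarith [sq_nonneg w]

lemma QQ_tend {w : ℝ} (hw : 0 < w) : Tendsto (fun r : ℝ => QQ r w) (𝓝[>] 0) (𝓝 (w : ℂ)) := by
  have h1 : ContinuousAt (fun r : ℝ => QQ r w) 0 := by
    unfold QQ
    refine ContinuousAt.cpow ?_ continuousAt_const ?_
    · fun_prop
    · left; rw [QQ_base_re]; positivity
  have h2 : QQ 0 w = w := by
    unfold QQ
    simp only [Complex.ofReal_zero, mul_zero, zero_mul, sub_zero]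
    exact Complex.sq_cpow_two_inv (by simpa using hw)
  have := h1.tendsto
  rw [h2] at this
  exact this.mono_left nhdsWithin_le_nhds

lemma Ioo01 : Set.Ioo (0:ℝ) 1 ∈ 𝓝[>] (0:ℝ) := Ioo_mem_nhdsGT one_pos

lemma int_w_gauss : ∫ w in Set.Ioi (0:ℝ), (Real.exp (-(1 * w ^ 2)) : ℂ) * (w : ℂ) = 1 / 2 := by
  have h := integral_mul_cexp_neg_mul_sq (b := 1) (by simp)
  rw [show ((2 : ℂ) * 1)⁻¹ = 1 / 2 by norm_num] at h
  rw [← h]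
  refine setIntegral_congr_fun measurableSet_Ioi (fun w _ => ?_)
  push_cast; rw [mul_comm]; congr 2; ring

lemma rM1_tend : Tendsto (fun r : ℝ => (r : ℂ) * MM 1 r) (𝓝[>] 0) (𝓝 (1 / 2)) := by
  rw [← int_w_gauss]
  have h := tendsto_integral_filter_of_dominated_convergence (μ := volume.restrict (Set.Ioi (0:ℝ)))
    (l := 𝓝[>] (0:ℝ))
    (F := fun r w => (Real.exp (-(1 * w ^ 2)) : ℂ) * ((w : ℂ) ^ (2 * 1) / QQ r w))
    (f := fun w => (Real.exp (-(1 * w ^ 2)) : ℂ) * (w : ℂ))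
    (fun w => w ^ 1 * Real.exp (-(1 * w ^ 2))) ?_ ?_ ?_ ?_
  · refine h.congr' ?_
    filter_upwards [self_mem_nhdsWithin] with r hr
    rw [← MM_scale 1 hr, pow_one]
  · filter_upwards [self_mem_nhdsWithin] with r hr
    have : Continuous (fun w : ℝ => (Real.exp (-(1 * w ^ 2)) : ℂ) * ((w : ℂ) ^ (2 * 1) / QQ r w)) :=
      (Complex.continuous_ofReal.comp (by fun_prop)).mul (mom_cont 1 hr)
    exact this.aestronglyMeasurable
  · filter_upwards [self_mem_nhdsWithin] with r hr
    filter_upwards [ae_restrict_mem measurableSet_Ioi] with w hw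
    have hw0 : (0:ℝ) < w := hw
    rw [norm_mul, norm_div, norm_pow, Complex.norm_real, Complex.norm_real, Real.norm_eq_abs,
      Real.norm_eq_abs, abs_of_pos (Real.exp_pos _), abs_of_pos hw0, mul_comm]
    have h1 := QQ_norm_ge r w
    rw [abs_of_pos hw0] at h1
    gcongr
    rw [div_le_iff₀ (by linarith), mul_one, pow_one]
    nlinarith
  · exact gauss_int 1 one_pos
  · filter_upwards [ae_restrict_mem measurableSet_Ioi] with w hw
    have hw0 : (0:ℝ) < w := hw
    have hwc : (w : ℂ) ≠ 0 := by exact_mod_cast hw0.ne'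
    have := ((tendsto_const_nhds (x := (w : ℂ) ^ (2 * 1))).div (QQ_tend hw0) hwc).const_mul
      (Real.exp (-(1 * w ^ 2)) : ℂ)
    have e : (w : ℂ) ^ (2 * 1) / w = w := by field_simp
    rw [e] at this
    exact this

lemma abs_log_le' {x : ℝ} (hx : 0 < x) : |Real.log x| ≤ x + 1 / x := by
  have h1 := Real.log_le_sub_one_of_pos hx
  have h2 := Real.log_le_sub_one_of_pos (inv_pos.2 hx)
  rw [Real.log_inv] at h2
  have h3 : 0 < x⁻¹ := inv_pos.2 hx
  rw [one_div, abs_le]; constructor <;> linarith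

lemma norm_clog_le {z : ℂ} {a : ℝ} (ha : 0 < a) (h : a ≤ ‖z‖) :
    ‖Complex.log z‖ ≤ ‖z‖ + 1 / a + 4 := by
  have h1 := Complex.norm_le_abs_re_add_abs_im (Complex.log z)
  rw [Complex.log_re, Complex.log_im] at h1
  have h2 := abs_log_le' (lt_of_lt_of_le ha h)
  have h3 := Complex.abs_arg_le_pi z
  have h4 := Real.pi_le_four
  have h5 : 1 / ‖z‖ ≤ 1 / a := one_div_le_one_div_of_le ha h
  linarith

/-- `w + √(w² - 2ir)` -/
def ZZ (r w : ℝ) : ℂ := w + QQ r w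

lemma ZZ_re {r w : ℝ} : (ZZ r w).re = w + (QQ r w).re := by simp [ZZ]

lemma ZZ_norm_ge {r w : ℝ} (hr : 0 < r) (hw : 0 ≤ w) : √r ≤ ‖ZZ r w‖ := by
  have := Complex.re_le_norm (ZZ r w)
  rw [ZZ_re] at this
  linarith [QQ_re_ge hr w]

lemma ZZ_norm_ge' {r w : ℝ} (hr : 0 < r) : w ≤ ‖ZZ r w‖ := by
  have := Complex.re_le_norm (ZZ r w)
  rw [ZZ_re] at this
  linarith [QQ_re_pos hr w]

lemma ZZ_norm_le {r w : ℝ} (hr : 0 < r) (hw : 0 ≤ w) : ‖ZZ r w‖ ≤ w + (1 + w ^ 2 + 2 * r) := by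
  refine (norm_add_le _ _).trans ?_
  rw [Complex.norm_real, Real.norm_eq_abs, abs_of_nonneg hw]
  linarith [QQ_norm_le hr w]

lemma ZZ_slit {r w : ℝ} (hr : 0 < r) (hw : 0 ≤ w) : ZZ r w ∈ Complex.slitPlane := by
  left; rw [ZZ_re]; linarith [QQ_re_pos hr w]

lemma ZZ_log_deriv {r w : ℝ} (hr : 0 < r) (hw : 0 ≤ w) :
    HasDerivAt (fun w => Complex.log (ZZ r w)) (1 / QQ r w) w := by
  have h2 : HasDerivAt (fun v : ℝ => (v : ℂ)) 1 w := Complex.ofRealCLM.hasDerivAt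
  have h3 : HasDerivAt (ZZ r) (1 + w / QQ r w) w := h2.add (QQ_deriv hr w)
  refine (h3.clog_real (ZZ_slit hr hw)).congr_deriv ?_
  have hne := QQ_ne_zero hr w
  have hz := Complex.slitPlane_ne_zero (ZZ_slit hr hw)
  field_simp
  unfold ZZ; ring

lemma ZZ_log_cont {r : ℝ} (hr : 0 < r) :
    ContinuousOn (fun w => Complex.log (ZZ r w)) (Set.Ioi 0) :=
  fun _ hw => (ZZ_log_deriv hr (le_of_lt hw)).continuousAt.continuousWithinAt

/-- The logarithmic integral. -/
def NN (r : ℝ) : ℂ := ∫ w in Set.Ioi (0:ℝ), (Real.exp (-(1 * w ^ 2)) : ℂ) * (2 * w * Complex.log (ZZ r w))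

lemma poly_aux {w : ℝ} (hw : 0 ≤ w) : w ≤ 1 + w ^ 3 ∧ w ^ 2 ≤ 1 + w ^ 3 := by
  have h3 : 0 ≤ w ^ 3 := by positivity
  rcases le_total w 1 with h | h
  · constructor <;> nlinarith
  · have : w ≤ w ^ 2 := by nlinarith
    have : w ^ 2 ≤ w ^ 3 := by nlinarith [sq_nonneg w]
    constructor <;> linarith

lemma NN_bound {r w : ℝ} (hr : 0 < r) (hr1 : r ≤ 1) (hw : 0 < w) :
    ‖2 * (w : ℂ) * Complex.log (ZZ r w)‖ ≤ 22 * (1 + w ^ 3) := by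
  have h1 := norm_clog_le hw (ZZ_norm_ge' (w := w) hr)
  have h2 := ZZ_norm_le (w := w) hr hw.le
  rw [norm_mul, norm_mul, Complex.norm_real, Real.norm_eq_abs, abs_of_pos hw]
  have h3 : ‖Complex.log (ZZ r w)‖ ≤ (w + w ^ 2 + 7) + 1 / w := by linarith
  obtain ⟨a, b⟩ := poly_aux hw.le
  calc ‖(2:ℂ)‖ * w * ‖Complex.log (ZZ r w)‖ ≤ 2 * w * ((w + w ^ 2 + 7) + 1 / w) := by
        rw [Complex.norm_ofNat]; gcongr
    _ = 2 * w ^ 2 + 2 * w ^ 3 + 14 * w + 2 := by field_simp; ring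
    _ ≤ _ := by nlinarith [pow_pos hw 3]

lemma NN_int {r : ℝ} (hr : 0 < r) (hr1 : r ≤ 1) : IntegrableOn (fun w : ℝ =>
    (Real.exp (-(1 * w ^ 2)) : ℂ) * (2 * w * Complex.log (ZZ r w))) (Set.Ioi 0) := by
  refine gauss_intC 3 one_pos 22 ?_ (fun w hw => NN_bound hr hr1 hw)
  exact ContinuousOn.mul (by fun_prop) (ZZ_log_cont hr)

lemma MM0_eq {r : ℝ} (hr : 0 < r) (hr1 : r ≤ 1) : MM 0 r = NN r - Complex.log (QQ r 0) := by
  have hs := MM_scale 0 hr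
  rw [pow_zero, one_mul] at hs
  have hitg0 : IntegrableOn (fun w : ℝ => (Real.exp (-(1 * w ^ 2)) : ℂ) * ((w : ℂ) ^ (2 * 0) / QQ r w))
      (Set.Ioi 0) := by
    refine gauss_intC 0 one_pos (1 / √r) (mom_cont 0 hr).continuousOn (fun w _ => ?_)
    have h1 : √r ≤ ‖QQ r w‖ := (QQ_re_ge hr w).trans (Complex.re_le_norm _)
    have h0 : 0 < √r := Real.sqrt_pos.2 hr
    rw [mul_zero, pow_zero, norm_div, norm_one]
    have := one_div_le_one_div_of_le h0 h1
    have : 0 < 1 / √r := by positivity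
    nlinarith [pow_zero w]
  set f : ℝ → ℂ := fun w => (Real.exp (-(1 * w ^ 2)) : ℂ) * Complex.log (ZZ r w) with hf
  set f' : ℝ → ℂ := fun w => (Real.exp (-(1 * w ^ 2)) : ℂ) * ((w : ℂ) ^ (2 * 0) / QQ r w)
    - (Real.exp (-(1 * w ^ 2)) : ℂ) * (2 * w * Complex.log (ZZ r w)) with hf'
  have hd : ∀ w ∈ Set.Ici (0:ℝ), HasDerivAt f (f' w) w := by
    intro w hw
    have h1 : HasDerivAt (fun v : ℝ => Real.exp (-(1 * v ^ 2)))
        (-(2 * w) * Real.exp (-(1 * w ^ 2))) w := by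
      refine (((hasDerivAt_pow 2 w).const_mul 1).neg.exp).congr_deriv ?_
      simp; ring
    refine (h1.ofReal_comp.mul (ZZ_log_deriv hr hw)).congr_deriv ?_
    simp only [hf']
    push_cast; ring
  have hitg' : IntegrableOn f' (Set.Ioi 0) := hitg0.sub (NN_int hr hr1)
  have hitg : IntegrableOn f (Set.Ioi 0) := by
    refine gauss_intC 3 one_pos (10 + 1 / √r) (ZZ_log_cont hr) (fun w hw => ?_)
    have h0 : 0 < √r := Real.sqrt_pos.2 hr
    have h1 := norm_clog_le h0 (ZZ_norm_ge hr hw.le)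
    have h2 := ZZ_norm_le (w := w) hr hw.le
    obtain ⟨a, b⟩ := poly_aux hw.le
    have h3 : 0 < 1 / √r := by positivity
    have h4 := mul_pos h3 (pow_pos hw 3)
    nlinarith [pow_pos hw 3]
  have hlim := tendsto_zero_of_hasDerivAt_of_integrableOn_Ioi
    (fun v hv => hd v (Set.mem_Ici.2 (le_of_lt hv))) hitg' hitg
  have hI := integral_Ioi_of_hasDerivAt_of_tendsto' hd hitg' hlim
  have hI2 : ∫ w in Set.Ioi (0:ℝ), f' w = MM 0 r - NN r := by
    simp only [hf']
    rw [integral_sub hitg0 (NN_int hr hr1), hs]; rfl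
  rw [hI2] at hI
  have hf0 : f 0 = Complex.log (QQ r 0) := by simp [hf, ZZ]
  rw [hf0] at hI
  linear_combination hI

lemma log_QQ0 {r : ℝ} (hr : 0 < r) :
    Complex.log (QQ r 0) = ((Real.log r + Real.log 2 : ℝ) : ℂ) / 2 - Real.pi / 4 * Complex.I := by
  have hb : ((0:ℝ) : ℂ) ^ 2 - 2 * r * Complex.I = ((r * 2 : ℝ) : ℂ) * (-Complex.I) := by
    push_cast; ring
  have hl : Complex.log (((r * 2 : ℝ) : ℂ) * (-Complex.I)) =
      ((Real.log r + Real.log 2 : ℝ) : ℂ) + (-(Real.pi / 2) * Complex.I) := by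
    rw [Complex.log_ofReal_mul (by positivity) (by simp), Complex.log_neg_I,
      Real.log_mul hr.ne' two_ne_zero]
  unfold QQ
  rw [hb, Complex.cpow_def_of_ne_zero (by simp [hr.ne']), hl]
  have e : (((Real.log r + Real.log 2 : ℝ) : ℂ) + (-(Real.pi / 2) * Complex.I)) * 2⁻¹ =
     (((Real.log r + Real.log 2) / 2 : ℝ) : ℂ) + ((-(Real.pi / 4) : ℝ) : ℂ) * Complex.I := by
    push_cast; ring
  rw [e, Complex.log_exp]
  · push_cast; ring
  · simp only [Complex.add_im, Complex.ofReal_im, Complex.mul_im, Complex.ofReal_re, Complex.I_re, Complex.I_im]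
    have := Real.pi_pos; linarith
  · simp only [Complex.add_im, Complex.ofReal_im, Complex.mul_im, Complex.ofReal_re, Complex.I_re, Complex.I_im]
    have := Real.pi_pos; linarith

lemma int_log_gamma : ∫ t in Set.Ioi (0:ℝ), (Real.log t * Real.exp (-t)) =
    - Real.eulerMascheroniConstant := by
  have h1 := Complex.hasDerivAt_GammaIntegral (s := 1) (by simp)
  have h2 : HasDerivAt Complex.GammaIntegral ((-Real.eulerMascheroniConstant : ℂ)) 1 := by
    refine Complex.hasDerivAt_Gamma_one.congr_of_eventuallyEq ?_
    have : {s : ℂ | 0 < s.re} ∈ 𝓝 (1 : ℂ) :=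
      (isOpen_lt continuous_const Complex.continuous_re).mem_nhds (by simp)
    filter_upwards [this] with s hs
    exact (Complex.Gamma_eq_integral hs).symm
  have h3 := h1.unique h2
  simp only [sub_self, Complex.cpow_zero, one_mul] at h3
  have h4 : ∫ t in Set.Ioi (0:ℝ), ((Real.log t * Real.exp (-t) : ℝ) : ℂ) =
    ((- Real.eulerMascheroniConstant : ℝ) : ℂ) := by
    rw [Complex.ofReal_neg, ← h3]
    refine setIntegral_congr_fun measurableSet_Ioi (fun w _ => ?_)
    push_cast; rfl
  rw [integral_complex_ofReal] at h4
  exact_mod_cast h4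

lemma int_log_gauss : ∫ w in Set.Ioi (0:ℝ), Real.exp (-(1 * w ^ 2)) * (2 * w * Real.log (2 * w)) =
    Real.log 2 - Real.eulerMascheroniConstant / 2 := by
  have h1 := integral_comp_rpow_Ioi_of_pos (g := fun t : ℝ => Real.log t * Real.exp (-t)) (p := 2) two_pos
  rw [int_log_gamma] at h1
  have h2 : ∫ w in Set.Ioi (0:ℝ), Real.exp (-(1 * w ^ 2)) * w = 1 / 2 := by
    have := int_w_gauss
    have h : ∫ w in Set.Ioi (0:ℝ), ((Real.exp (-(1 * w ^ 2)) * w : ℝ) : ℂ) = ((1 / 2 : ℝ) : ℂ) := by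
      push_cast at this ⊢; exact this
    rw [integral_complex_ofReal] at h
    exact_mod_cast h
  have i2 : IntegrableOn (fun w : ℝ => Real.exp (-(1 * w ^ 2)) * w) (Set.Ioi 0) := by
    refine (gauss_int 1 one_pos).congr_fun (fun w _ => ?_) measurableSet_Ioi
    simp only [pow_one]; ring
  have i1 : IntegrableOn (fun w : ℝ => Real.exp (-(1 * w ^ 2)) * (w * Real.log w)) (Set.Ioi 0) := by
    refine Integrable.mono' ((gauss_int 0 one_pos).add (gauss_int 2 one_pos)) ?_ ?_
    · have : Continuous (fun w : ℝ => Real.exp (-(1 * w ^ 2)) * (w * Real.log w)) := by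
        have := Real.continuous_mul_log
        fun_prop
      exact this.aestronglyMeasurable
    · filter_upwards [ae_restrict_mem measurableSet_Ioi] with w hw
      have hw0 : (0:ℝ) < w := hw
      rw [Real.norm_eq_abs, abs_mul, abs_of_pos (Real.exp_pos _), abs_mul, abs_of_pos hw0]
      have := abs_log_le' hw0
      have h3 : w * |Real.log w| ≤ w ^ 2 + 1 := by
        calc w * |Real.log w| ≤ w * (w + 1 / w) := by gcongr
          _ = _ := by field_simp
      have he := Real.exp_pos (-(1 * w ^ 2))
      simp only [Pi.add_apply, pow_zero, one_mul] at he ⊢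
      nlinarith
  have h3 : ∫ w in Set.Ioi (0:ℝ), Real.exp (-(1 * w ^ 2)) * (w * Real.log w) =
      - Real.eulerMascheroniConstant / 4 := by
    have e : ∀ w ∈ Set.Ioi (0:ℝ), ((2:ℝ) * w ^ ((2:ℝ) - 1)) • (Real.log (w ^ (2:ℝ)) * Real.exp (-(w ^ (2:ℝ))))
        = 4 * (Real.exp (-(1 * w ^ 2)) * (w * Real.log w)) := by
      intro w hw
      have hw0 : (0:ℝ) < w := hw
      rw [Real.log_rpow hw0, show (2:ℝ) - 1 = 1 by norm_num, Real.rpow_one, Real.rpow_two, smul_eq_mul,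
        one_mul]
      ring
    rw [setIntegral_congr_fun measurableSet_Ioi e, integral_const_mul] at h1
    linarith
  have e : ∀ w ∈ Set.Ioi (0:ℝ), Real.exp (-(1 * w ^ 2)) * (2 * w * Real.log (2 * w)) =
      2 * Real.log 2 * (Real.exp (-(1 * w ^ 2)) * w) + 2 * (Real.exp (-(1 * w ^ 2)) * (w * Real.log w)) := by
    intro w hw
    have hw0 : (0:ℝ) < w := hw
    rw [Real.log_mul two_ne_zero hw0.ne']; ring
  rw [setIntegral_congr_fun measurableSet_Ioi e, integral_add (i2.const_mul _) (i1.const_mul _),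
    integral_const_mul, integral_const_mul, h2, h3]
  ring

lemma NN_tend : Tendsto NN (𝓝[>] 0)
    (𝓝 ((Real.log 2 - Real.eulerMascheroniConstant / 2 : ℝ) : ℂ)) := by
  rw [← int_log_gauss, ← integral_complex_ofReal]
  refine tendsto_integral_filter_of_dominated_convergence (μ := volume.restrict (Set.Ioi (0:ℝ)))
    (l := 𝓝[>] (0:ℝ))
    (fun w => 22 * (w ^ 0 * Real.exp (-(1 * w ^ 2)) + w ^ 3 * Real.exp (-(1 * w ^ 2)))) ?_ ?_ ?_ ?_
  · filter_upwards [Ioo01] with r hr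
    exact (NN_int hr.1 hr.2.le).aestronglyMeasurable
  · filter_upwards [Ioo01] with r hr
    filter_upwards [ae_restrict_mem measurableSet_Ioi] with w hw
    rw [norm_mul, Complex.norm_real, Real.norm_eq_abs, abs_of_pos (Real.exp_pos _)]
    have := NN_bound hr.1 hr.2.le hw
    have he := Real.exp_pos (-(1 * w ^ 2))
    rw [pow_zero]
    nlinarith
  · exact ((gauss_int 0 one_pos).add (gauss_int 3 one_pos)).const_mul 22
  · filter_upwards [ae_restrict_mem measurableSet_Ioi] with w hw
    have hw0 : (0:ℝ) < w := hw
    have h1 : Tendsto (fun r => ZZ r w) (𝓝[>] 0) (𝓝 ((2 * w : ℝ) : ℂ)) := by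
      have := (tendsto_const_nhds (x := (w : ℂ))).add (QQ_tend hw0)
      rw [show ((2 * w : ℝ) : ℂ) = w + w by push_cast; ring]
      exact this
    have h2 := (h1.clog (by left; simpa using hw0)).const_mul (2 * (w : ℂ))
    have h3 := h2.const_mul (Real.exp (-(1 * w ^ 2)) : ℂ)
    rw [← Complex.ofReal_log (by positivity)] at h3
    convert h3 using 2
    push_cast; rfl

/-- `log (r/2) + γ`. -/
def ell (r : ℝ) : ℝ := Real.log (r / 2) + Real.eulerMascheroniConstant

lemma MM0_tend : Tendsto (fun r : ℝ => MM 0 r + (ell r : ℂ) / 2) (𝓝[>] 0)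
    (𝓝 (Real.pi / 4 * Complex.I)) := by
  have h := NN_tend.add_const ((Real.pi / 4 * Complex.I) -
    ((Real.log 2 - Real.eulerMascheroniConstant / 2 : ℝ) : ℂ))
  rw [add_sub_cancel] at h
  refine h.congr' ?_
  filter_upwards [Ioo01] with r hr
  rw [MM0_eq hr.1 hr.2.le, log_QQ0 hr.1, ell, Real.log_div hr.1.ne' two_ne_zero]
  push_cast; ring

lemma rell_tend : Tendsto (fun r : ℝ => (r : ℂ) * (ell r : ℂ)) (𝓝[>] 0) (𝓝 0) := by
  have h := (Complex.continuous_ofReal.tendsto 0).comp r_log_tend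
  rw [Complex.ofReal_zero] at h
  refine h.congr (fun r => ?_)
  simp [ell]

lemma rC_tend : Tendsto (fun r : ℝ => (r : ℂ)) (𝓝[>] 0) (𝓝 0) := by
  have h := (Complex.continuous_ofReal.tendsto 0).comp id_tend0
  exact h

lemma rM0_tend : Tendsto (fun r : ℝ => (r : ℂ) * MM 0 r) (𝓝[>] 0) (𝓝 0) := by
  have h := (rC_tend.mul MM0_tend).sub (rell_tend.div_const 2)
  simp only [zero_mul, zero_div, sub_zero] at h
  refine h.congr (fun r => ?_)
  ring

lemma expI_tend : Tendsto (fun r : ℝ => Complex.exp (Complex.I * r)) (𝓝[>] 0) (𝓝 1) := by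
  have := (expI_deriv 0).continuousAt.tendsto
  simp only [Complex.ofReal_zero, mul_zero, Complex.exp_zero] at this
  exact this.mono_left nhdsWithin_le_nhds

lemma uG_tend : Tendsto (fun r : ℝ => uG r + (ell r : ℂ) / 2) (𝓝[>] 0)
    (𝓝 (Real.pi / 4 * Complex.I)) := by
  have hd := (expI_deriv 0).tendsto_slope_zero_right
  simp only [Complex.ofReal_zero, mul_zero, Complex.exp_zero, mul_one, zero_add] at hd
  have h := (hd.mul rM0_tend).add MM0_tend
  simp only [mul_zero, zero_add] at h
  refine h.congr' ?_
  filter_upwards [self_mem_nhdsWithin] with r hr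
  have : (r : ℂ) ≠ 0 := by exact_mod_cast (ne_of_gt hr)
  rw [Complex.real_smul, Complex.ofReal_inv, uG]
  field_simp
  ring

lemma pG_tend : Tendsto pG (𝓝[>] 0) (𝓝 (-(1 / 2))) := by
  have h := expI_tend.mul ((rM1_tend.neg).add (rM0_tend.const_mul Complex.I))
  simp only [mul_zero, add_zero, one_mul] at h
  refine h.congr (fun r => ?_)
  unfold pG; ring

lemma hankel_eq {r : ℝ} (hr : 0 < r) : hankelH10 r = -(4 * Complex.I / Real.pi) * uG r := by
  have hpi : (Real.pi : ℂ) ≠ 0 := by exact_mod_cast Real.pi_ne_zero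
  have h := bessel_unique
    (fun r => (besselJ0 r : ℂ) + (2 * Complex.I / Real.pi) * (uK r : ℂ) + (4 * Complex.I / Real.pi) * uG r)
    (fun r => (pJ r : ℂ) + (2 * Complex.I / Real.pi) * (pK r : ℂ) + (4 * Complex.I / Real.pi) * pG r)
    ?_ ?_ ?_ ?_ r hr
  · have e : hankelH10 r = (besselJ0 r : ℂ) + (2 * Complex.I / Real.pi) * (uK r : ℂ) := by
      unfold hankelH10
      rw [besselY0_eq, ← uK]
      push_cast; ring
    rw [e]
    linear_combination h
  · intro r hr
    refine (((J0_deriv hr).ofReal_comp.add ((uK_deriv hr).ofReal_comp.const_mul _)).add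
      ((uG_deriv hr).const_mul _)).congr_deriv ?_
    push_cast; ring
  · intro r hr
    refine (((pJ_deriv r).ofReal_comp.add ((pK_deriv hr).ofReal_comp.const_mul _)).add
      ((pG_deriv hr).const_mul _)).congr_deriv ?_
    push_cast; ring
  · have h1 := (Complex.continuous_ofReal.tendsto _).comp J0_tend
    have h2 := (Complex.continuous_ofReal.tendsto _).comp uK_tend
    have h3 := (h1.add (h2.const_mul (2 * Complex.I / Real.pi))).add
      (uG_tend.const_mul (4 * Complex.I / Real.pi))
    have e : ((1:ℝ) : ℂ) + (2 * Complex.I / Real.pi) * ((0:ℝ) : ℂ) +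
        (4 * Complex.I / Real.pi) * (Real.pi / 4 * Complex.I) = 0 := by
      push_cast; field_simp; simp
    rw [e] at h3
    refine h3.congr (fun r => ?_)
    simp only [Function.comp, ell]
    push_cast; ring
  · have h1 := (Complex.continuous_ofReal.tendsto _).comp pJ_tend
    have h2 := (Complex.continuous_ofReal.tendsto _).comp pK_tend
    have h3 := (h1.add (h2.const_mul (2 * Complex.I / Real.pi))).add
      (pG_tend.const_mul (4 * Complex.I / Real.pi))
    have e : ((0:ℝ) : ℂ) + (2 * Complex.I / Real.pi) * ((1:ℝ) : ℂ) +
        (4 * Complex.I / Real.pi) * (-(1 / 2)) = 0 := by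
      push_cast; ring
    rw [e] at h3
    exact h3

/-- Large `r` asymptotics of the scaled integral. -/
lemma MM0_large : Tendsto (fun r : ℝ => ((√r : ℝ) : ℂ) * MM 0 r) atTop
    (𝓝 (((√Real.pi / 2 : ℝ) : ℂ) / QQ 1 0)) := by
  have hI : ∫ w in Set.Ioi (0:ℝ), (Real.exp (-(1 * w ^ 2)) : ℂ) * (1 / QQ 1 0) =
      ((√Real.pi / 2 : ℝ) : ℂ) / QQ 1 0 := by
    rw [integral_mul_const, integral_complex_ofReal]
    have := integral_gaussian_Ioi 1
    simp only [neg_mul, div_one] at this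
    rw [this]; ring
  rw [← hI]
  have h := tendsto_integral_filter_of_dominated_convergence (μ := volume.restrict (Set.Ioi (0:ℝ)))
    (l := atTop)
    (F := fun (r : ℝ) w => (Real.exp (-(1 * w ^ 2)) : ℂ) * (1 / QQ 1 (w / √r)))
    (f := fun w => (Real.exp (-(1 * w ^ 2)) : ℂ) * (1 / QQ 1 0))
    (fun w => w ^ 0 * Real.exp (-(1 * w ^ 2))) ?_ ?_ ?_ ?_
  · refine h.congr' ?_
    filter_upwards [eventually_gt_atTop 0] with r hr
    have hs := MM_scale 0 hr
    rw [pow_zero, one_mul] at hs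
    rw [hs, ← integral_const_mul]
    refine integral_congr_ae (Eventually.of_forall fun w => ?_)
    have hsr : (√r) ≠ 0 := (Real.sqrt_pos.2 hr).ne'
    have h1 := QQ_scale hr (w / √r)
    rw [mul_div_cancel₀ _ hsr] at h1
    have hne := QQ_ne_zero one_pos (w / √r)
    have hsc : ((√r : ℝ) : ℂ) ≠ 0 := by exact_mod_cast hsr
    simp only [mul_zero, pow_zero]
    rw [h1]; field_simp
  · filter_upwards with r
    have : Continuous (fun w : ℝ => (Real.exp (-(1 * w ^ 2)) : ℂ) * (1 / QQ 1 (w / √r))) := by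
      refine (Complex.continuous_ofReal.comp (by fun_prop)).mul
        (continuous_const.div ((QQ_cont one_pos).comp (by fun_prop)) (fun w => QQ_ne_zero one_pos _))
    exact this.aestronglyMeasurable
  · filter_upwards with r
    filter_upwards with w
    rw [norm_mul, norm_div, Complex.norm_real, Real.norm_eq_abs,
      abs_of_pos (Real.exp_pos _), pow_zero, one_mul, norm_one]
    have h1 := QQ_one_ge (w / √r)
    have : 1 / ‖QQ 1 (w / √r)‖ ≤ 1 := by
      rw [div_le_one (by linarith)]; exact h1
    have he := Real.exp_pos (-(1 * w ^ 2))
    simp only [one_mul] at he ⊢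
    nlinarith
  · exact gauss_int 0 one_pos
  · filter_upwards with w
    refine Tendsto.const_mul _ (tendsto_const_nhds.div ?_ (QQ_ne_zero one_pos 0))
    have h1 : Tendsto (fun r : ℝ => w / √r) atTop (𝓝 0) :=
      tendsto_const_nhds.div_atTop Real.tendsto_sqrt_atTop
    exact ((QQ_cont one_pos).tendsto 0).comp h1

/-- The limiting amplitude. -/
def amp : ℂ := -(4 * Complex.I / Real.pi) * (((√Real.pi / 2 : ℝ) : ℂ) / QQ 1 0)

lemma amp_norm_sq : ‖amp‖ ^ 2 = 2 / Real.pi := by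
  unfold amp
  rw [norm_mul, norm_div, norm_neg, norm_div, norm_mul, Complex.norm_I, Complex.norm_real,
    Complex.norm_real, mul_pow, div_pow, div_pow, QQ_norm_sq]
  have hp := Real.pi_pos
  rw [Real.norm_eq_abs, Real.norm_eq_abs, sq_abs, sq_abs, div_pow, Real.sq_sqrt hp.le]
  simp
  field_simp
  norm_num

/-- `√r e^{-ir} H₀(r)`. -/
def hsc (r : ℝ) : ℂ := ((√r : ℝ) : ℂ) * Complex.exp (-(Complex.I * r)) * hankelH10 r

lemma hsc_tend : Tendsto hsc atTop (𝓝 amp) := by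
  have h := MM0_large.const_mul (-(4 * Complex.I / Real.pi))
  refine h.congr' ?_
  filter_upwards [eventually_gt_atTop 0] with r hr
  unfold hsc
  rw [hankel_eq hr, uG, Complex.exp_neg]
  have := Complex.exp_ne_zero (Complex.I * r)
  field_simp

lemma hankel_hsc {r : ℝ} (hr : 0 < r) :
    hankelH10 r = hsc r * Complex.exp (Complex.I * r) / ((√r : ℝ) : ℂ) := by
  unfold hsc
  have h1 : ((√r : ℝ) : ℂ) ≠ 0 := by exact_mod_cast (Real.sqrt_pos.2 hr).ne'
  rw [Complex.exp_neg]
  have := Complex.exp_ne_zero (Complex.I * r)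
  field_simp

lemma hankel_cont : ContinuousOn hankelH10 (Set.Ioi 0) := by
  intro r hr
  have : HasDerivAt hankelH10 ((pJ r / r : ℝ) + Complex.I * ((2 / Real.pi * (pK r / r) : ℝ) : ℂ)) r := by
    refine (J0_deriv hr).ofReal_comp.add (HasDerivAt.const_mul _ (HasDerivAt.ofReal_comp ?_))
    have e : besselY0 = fun x => 2 / Real.pi * uK x := by
      funext x; rw [besselY0_eq]; rfl
    rw [e]
    exact (uK_deriv hr).const_mul _
  exact this.continuousAt.continuousWithinAt

lemma prod_even (n : ℕ) : (∏ i ∈ Finset.range n, (2 * (i : ℝ) + 1) / (2 * i + 2)) =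
    ((2 * n).factorial : ℝ) / (4 ^ n * (n.factorial : ℝ) ^ 2) := by
  induction n with
  | zero => simp
  | succ k ih =>
    rw [Finset.prod_range_succ, ih, show 2 * (k + 1) = 2 * k + 1 + 1 by ring, Nat.factorial_succ,
      Nat.factorial_succ, Nat.factorial_succ]
    have h0 : (k.factorial : ℝ) ≠ 0 := by exact_mod_cast k.factorial_ne_zero
    push_cast
    field_simp
    ring

lemma bessel_int (a : ℝ) : ∫ θ in (0:ℝ)..Real.pi, Real.cos (a * Real.sin θ) = Real.pi * besselJ0 a := by
  have h := intervalIntegral.hasSum_integral_of_dominated_convergence (μ := volume)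
    (a := 0) (b := Real.pi)
    (F := fun (n : ℕ) (θ : ℝ) => (-1) ^ n * (a * Real.sin θ) ^ (2 * n) / ((2 * n).factorial : ℝ))
    (f := fun θ => Real.cos (a * Real.sin θ))
    (fun n _ => |a| ^ (2 * n) / ((2 * n).factorial : ℝ)) ?_ ?_ ?_ ?_ ?_
  · rw [← h.tsum_eq]
    unfold besselJ0
    rw [← tsum_mul_left]
    refine tsum_congr (fun n => ?_)
    have e : ∀ θ : ℝ, (-1) ^ n * (a * Real.sin θ) ^ (2 * n) / ((2 * n).factorial : ℝ) =
      ((-1) ^ n * a ^ (2 * n) / ((2 * n).factorial : ℝ)) * Real.sin θ ^ (2 * n) := by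
      intro θ; rw [mul_pow]; ring
    simp only [e]
    rw [intervalIntegral.integral_const_mul, integral_sin_pow_even, prod_even, div_pow, pow_mul (2:ℝ)]
    have h0 : (n.factorial : ℝ) ≠ 0 := by exact_mod_cast n.factorial_ne_zero
    have h1 : ((2 * n).factorial : ℝ) ≠ 0 := by exact_mod_cast (2 * n).factorial_ne_zero
    norm_num
    field_simp
  · intro n
    exact Continuous.aestronglyMeasurable (by fun_prop)
  · intro n
    filter_upwards with θ _
    rw [norm_div, norm_mul, norm_pow, norm_neg, norm_one, one_pow, one_mul, norm_pow, norm_mul,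
      Real.norm_eq_abs, Real.norm_eq_abs, Real.norm_eq_abs, Nat.abs_cast]
    gcongr
    have := Real.abs_sin_le_one θ
    nlinarith [abs_nonneg a]
  · filter_upwards with θ _
    exact (Real.summable_pow_div_factorial |a|).comp_injective
      (fun m n h => by simpa using h : Function.Injective (fun n : ℕ => 2 * n))
  · exact intervalIntegrable_const
  · filter_upwards with θ _
    exact Real.hasSum_cos _

lemma bessel_intC (a c : ℝ) : ∫ θ in (0:ℝ)..(2 * Real.pi),
    Complex.exp (Complex.I * ((a * Real.sin (θ + c) : ℝ) : ℂ)) = ((2 * Real.pi * besselJ0 a : ℝ) : ℂ) := by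
  set g : ℝ → ℂ := fun θ => Complex.exp (Complex.I * ((a * Real.sin θ : ℝ) : ℂ)) with hg
  have hcont : Continuous g := by
    simp only [hg]; fun_prop
  have hper : Function.Periodic g (2 * Real.pi) := by
    intro θ; simp only [hg, Real.sin_add_two_pi]
  have h1 : ∫ θ in (0:ℝ)..(2 * Real.pi), g (θ + c) = ∫ θ in (0:ℝ)..(0 + 2 * Real.pi), g θ := by
    rw [intervalIntegral.integral_comp_add_right, zero_add, add_comm (2 * Real.pi) c]
    exact hper.intervalIntegral_add_eq c 0
  change ∫ θ in (0:ℝ)..(2 * Real.pi), g (θ + c) = _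
  rw [h1, zero_add, ← intervalIntegral.integral_add_adjacent_intervals
    (hcont.intervalIntegrable 0 Real.pi) (hcont.intervalIntegrable Real.pi (2 * Real.pi))]
  have h2 : ∫ θ in Real.pi..(2 * Real.pi), g θ = ∫ θ in (0:ℝ)..Real.pi, g (θ + Real.pi) := by
    rw [intervalIntegral.integral_comp_add_right, zero_add, two_mul]
  have hc2 : Continuous (fun θ => g (θ + Real.pi)) := hcont.comp (continuous_add_const _)
  rw [h2, ← intervalIntegral.integral_add (hcont.intervalIntegrable _ _)
    (hc2.intervalIntegrable _ _)]
  have e : ∀ θ : ℝ, g θ + g (θ + Real.pi) = ((2 * Real.cos (a * Real.sin θ) : ℝ) : ℂ) := by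
    intro θ
    simp only [hg, Real.sin_add_pi]
    rw [Complex.ofReal_mul 2, Complex.ofReal_cos, Complex.ofReal_ofNat, Complex.two_cos]
    congr 1 <;> congr 1 <;> push_cast <;> ring
  simp only [e]
  rw [intervalIntegral.integral_ofReal, intervalIntegral.integral_const_mul, bessel_int]
  push_cast; ring

lemma circle_eq (R θ : ℝ) : circlePt R θ = R • circlePt 1 θ := by
  ext i; fin_cases i <;> simp [circlePt]

lemma circle_norm (θ : ℝ) : ‖circlePt 1 θ‖ = 1 := by
  rw [EuclideanSpace.norm_eq]; simp [circlePt, Fin.sum_univ_two]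

lemma circle_inner (θ : ℝ) (w : EuclideanSpace ℝ (Fin 2)) :
    inner ℝ (circlePt 1 θ) w = w 0 * Real.cos θ + w 1 * Real.sin θ := by
  simp [circlePt, PiLp.inner_apply, Fin.sum_univ_two]

lemma circle_int (k : ℝ) (w : EuclideanSpace ℝ (Fin 2)) : ∫ θ in (0:ℝ)..(2 * Real.pi),
    Complex.exp (Complex.I * ((k * inner ℝ (circlePt 1 θ) w : ℝ) : ℂ)) =
    ((2 * Real.pi * besselJ0 (k * ‖w‖) : ℝ) : ℂ) := by
  set ζ : ℂ := ⟨w 0, w 1⟩ with hζ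
  have hn : ‖w‖ = ‖ζ‖ := by
    rw [EuclideanSpace.norm_eq, Complex.norm_def, Complex.normSq_apply]
    simp [Fin.sum_univ_two, hζ, sq]
  have h0 : ‖ζ‖ * Real.cos ζ.arg = w 0 := by rw [Complex.norm_mul_cos_arg]
  have h1 : ‖ζ‖ * Real.sin ζ.arg = w 1 := by rw [Complex.norm_mul_sin_arg]
  rw [← bessel_intC (k * ‖w‖) (Real.pi / 2 - ζ.arg)]
  refine intervalIntegral.integral_congr (fun θ _ => ?_)
  congr 3
  rw [circle_inner, show θ + (Real.pi / 2 - ζ.arg) = (θ - ζ.arg) + Real.pi / 2 by ring,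
    Real.sin_add_pi_div_two, Real.cos_sub, hn, ← h0, ← h1]
  ring

section asymp
variable {V : Type*} [NormedAddCommGroup V] [InnerProductSpace ℝ V]

lemma dist_bound (e y : V) (he : ‖e‖ = 1) {R : ℝ} (hR : 0 < R) : |‖R • e - y‖ - R| ≤ ‖y‖ := by
  have h := abs_norm_sub_norm_le (R • e - y) (R • e)
  rw [norm_smul, he, Real.norm_eq_abs, abs_of_pos hR, mul_one] at h
  simpa using h

lemma ratio_tend (e y : V) (he : ‖e‖ = 1) :
    Tendsto (fun R : ℝ => ‖R • e - y‖ / R) atTop (𝓝 1) := by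
  rw [tendsto_iff_norm_sub_tendsto_zero]
  have h : Tendsto (fun R : ℝ => ‖y‖ / R) atTop (𝓝 0) := tendsto_const_nhds.div_atTop tendsto_id
  refine squeeze_zero' (Eventually.of_forall fun _ => norm_nonneg _) ?_ h
  filter_upwards [eventually_gt_atTop 0] with R hR
  have e1 : ‖R • e - y‖ / R - 1 = (‖R • e - y‖ - R) / R := by field_simp
  rw [e1, Real.norm_eq_abs, abs_div, abs_of_pos hR]
  gcongr
  exact dist_bound e y he hR

lemma diff_tend (e y : V) (he : ‖e‖ = 1) :
    Tendsto (fun R : ℝ => ‖R • e - y‖ - R) atTop (𝓝 (-inner ℝ e y)) := by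
  have h1 : Tendsto (fun R : ℝ => ‖y‖ ^ 2 / R) atTop (𝓝 0) := tendsto_const_nhds.div_atTop tendsto_id
  have h2 := (h1.const_add (-2 * inner ℝ e y)).div ((ratio_tend e y he).add_const 1) (by norm_num)
  have h3 : (-2 * inner ℝ e y + 0) / (1 + 1) = -inner ℝ e y := by ring
  rw [h3] at h2
  refine h2.congr' ?_
  filter_upwards [eventually_gt_atTop 0] with R hR
  have hsq : ‖R • e - y‖ ^ 2 = R ^ 2 - 2 * (R * inner ℝ e y) + ‖y‖ ^ 2 := by
    rw [norm_sub_sq_real, norm_smul, he, inner_smul_left, Real.norm_eq_abs, abs_of_pos hR]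
    simp
  have hpos : 0 < ‖R • e - y‖ + R := by positivity
  simp only [Pi.div_apply]
  rw [div_eq_iff (by positivity)]
  field_simp
  linear_combination -hsq
end asymp

/-- The integrand of the identity, rewritten through the scaled Hankel function. -/
def integrandForm (k A B R : ℝ) : ℂ :=
  (1 / 16) * ((starRingEnd ℂ) (hsc (k * A)) * hsc (k * B)) *
    Complex.exp (Complex.I * ((k * (B - A) : ℝ) : ℂ)) *
    ((1 / (√(k * (A / R)) * √(k * (B / R))) : ℝ) : ℂ)

lemma sqrt_split {k A R : ℝ} (hk : 0 < k) (hA : 0 < A) (hR : 0 < R) :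
    √(k * A) = √(k * (A / R)) * √R := by
  rw [← Real.sqrt_mul (by positivity)]
  congr 1
  field_simp

lemma integrand_eq {k R : ℝ} (hk : 0 < k) (hR : 0 < R) (u v : EuclideanSpace ℝ (Fin 2))
    (hA : 0 < ‖u‖) (hB : 0 < ‖v‖) :
    (starRingEnd ℂ) (gammaK k u) * gammaK k v * (R : ℂ) = integrandForm k ‖u‖ ‖v‖ R := by
  unfold gammaK integrandForm
  rw [hankel_hsc (mul_pos hk hA), hankel_hsc (mul_pos hk hB)]
  generalize hsc (k * ‖u‖) = p
  generalize hsc (k * ‖v‖) = q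
  rw [sqrt_split hk hA hR, sqrt_split hk hB hR]
  have h1 : √(k * (‖u‖ / R)) ≠ 0 := by positivity
  have h2 : √(k * (‖v‖ / R)) ≠ 0 := by positivity
  have h3 : √R ≠ 0 := by positivity
  have h4 : √R ^ 2 = R := Real.sq_sqrt hR.le
  generalize √(k * (‖u‖ / R)) = s at *
  generalize √(k * (‖v‖ / R)) = t at *
  generalize √R = w at *
  have he : Complex.exp (Complex.I * ((k * (‖v‖ - ‖u‖) : ℝ) : ℂ)) =
      Complex.exp (-(Complex.I * ((k * ‖u‖ : ℝ) : ℂ))) *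
        Complex.exp (Complex.I * ((k * ‖v‖ : ℝ) : ℂ)) := by
    rw [← Complex.exp_add]; congr 1; push_cast; ring
  rw [he, ← h4]
  simp only [map_mul, map_div₀, map_neg, Complex.conj_ofReal, ← Complex.exp_conj, Complex.conj_I,
    map_ofNat]
  rw [neg_mul Complex.I]
  generalize Complex.exp (-(Complex.I * ((k * ‖u‖ : ℝ) : ℂ))) = E1
  generalize Complex.exp (Complex.I * ((k * ‖v‖ : ℝ) : ℂ)) = E2
  have h1' : (s : ℂ) ≠ 0 := by exact_mod_cast h1
  have h2' : (t : ℂ) ≠ 0 := by exact_mod_cast h2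
  have h3' : (w : ℂ) ≠ 0 := by exact_mod_cast h3
  push_cast
  field_simp
  linear_combination (-16 * (starRingEnd ℂ) p * q * E1 * E2) * Complex.I_sq

lemma dist_lower {R : ℝ} (θ : ℝ) (y : EuclideanSpace ℝ (Fin 2)) (hR : 0 < R) (h : 2 * ‖y‖ ≤ R) :
    R / 2 ≤ ‖circlePt R θ - y‖ := by
  have := dist_bound (circlePt 1 θ) y (circle_norm θ) hR
  rw [← circle_eq] at this
  have := (abs_le.1 this).1
  linarith

lemma dist_atTop (θ : ℝ) (y : EuclideanSpace ℝ (Fin 2)) :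
    Tendsto (fun R => ‖circlePt R θ - y‖) atTop atTop := by
  refine tendsto_atTop_mono' _ ?_ (tendsto_id.atTop_div_const (show (0:ℝ) < 2 by norm_num))
  filter_upwards [eventually_gt_atTop 0, eventually_ge_atTop (2 * ‖y‖)] with R h1 h2
  exact dist_lower θ y h1 h2

lemma integrand_lim {k : ℝ} (hk : 0 < k) (y z : EuclideanSpace ℝ (Fin 2)) (θ : ℝ) :
    Tendsto (fun R => integrandForm k ‖circlePt R θ - y‖ ‖circlePt R θ - z‖ R) atTop
      (𝓝 (((1 / (8 * Real.pi * k) : ℝ) : ℂ) *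
        Complex.exp (Complex.I * ((k * inner ℝ (circlePt 1 θ) (y - z) : ℝ) : ℂ)))) := by
  have hy := hsc_tend.comp ((dist_atTop θ y).const_mul_atTop hk)
  have hz := hsc_tend.comp ((dist_atTop θ z).const_mul_atTop hk)
  have hd : Tendsto (fun R => k * (‖circlePt R θ - z‖ - ‖circlePt R θ - y‖)) atTop
      (𝓝 (k * inner ℝ (circlePt 1 θ) (y - z))) := by
    have h := ((diff_tend (circlePt 1 θ) z (circle_norm θ)).sub
      (diff_tend (circlePt 1 θ) y (circle_norm θ))).const_mul k
    have e : -inner ℝ (circlePt 1 θ) z - -inner ℝ (circlePt 1 θ) y =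
        inner ℝ (circlePt 1 θ) (y - z) := by rw [inner_sub_right]; ring
    rw [e] at h
    refine h.congr (fun R => ?_)
    rw [← circle_eq]; ring
  have hr : ∀ w : EuclideanSpace ℝ (Fin 2),
      Tendsto (fun R => √(k * (‖circlePt R θ - w‖ / R))) atTop (𝓝 (√k)) := by
    intro w
    have h := ((ratio_tend (circlePt 1 θ) w (circle_norm θ)).const_mul k).sqrt
    rw [mul_one] at h
    refine h.congr (fun R => ?_)
    rw [← circle_eq]
  have hq : Tendsto (fun R => 1 / (√(k * (‖circlePt R θ - y‖ / R)) * √(k * (‖circlePt R θ - z‖ / R))))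
      atTop (𝓝 (1 / (√k * √k))) :=
    tendsto_const_nhds.div ((hr y).mul (hr z)) (by positivity)
  rw [Real.mul_self_sqrt hk.le] at hq
  have hE : Tendsto (fun R => Complex.exp (Complex.I *
      ((k * (‖circlePt R θ - z‖ - ‖circlePt R θ - y‖) : ℝ) : ℂ))) atTop
      (𝓝 (Complex.exp (Complex.I * ((k * inner ℝ (circlePt 1 θ) (y - z) : ℝ) : ℂ)))) :=
    (((Complex.continuous_ofReal.tendsto _).comp hd).const_mul Complex.I).cexp
  have hc := (Complex.continuous_conj.tendsto amp).comp hy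
  have hfin := ((((hc.mul hz).const_mul (1 / 16 : ℂ)).mul hE).mul
    ((Complex.continuous_ofReal.tendsto _).comp hq))
  have hval : (starRingEnd ℂ) amp * amp = ((2 / Real.pi : ℝ) : ℂ) := by
    rw [Complex.conj_mul', ← amp_norm_sq]; push_cast; rfl
  rw [hval] at hfin
  have e2 : (1 / 16 : ℂ) * ((2 / Real.pi : ℝ) : ℂ) *
      Complex.exp (Complex.I * ((k * inner ℝ (circlePt 1 θ) (y - z) : ℝ) : ℂ)) *
      ((1 / k : ℝ) : ℂ) = ((1 / (8 * Real.pi * k) : ℝ) : ℂ) *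
        Complex.exp (Complex.I * ((k * inner ℝ (circlePt 1 θ) (y - z) : ℝ) : ℂ)) := by
    have h1 : (k : ℂ) ≠ 0 := by exact_mod_cast hk.ne'
    have h2 : (Real.pi : ℂ) ≠ 0 := by exact_mod_cast Real.pi_ne_zero
    generalize Complex.exp (Complex.I * ((k * inner ℝ (circlePt 1 θ) (y - z) : ℝ) : ℂ)) = E1
    push_cast
    field_simp
    ring
  rw [e2] at hfin
  exact hfin

lemma hsc_bdd : ∃ ρ : ℝ, ∀ r, ρ ≤ r → ‖hsc r‖ ≤ ‖amp‖ + 1 := by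
  have h := hsc_tend.norm.eventually (eventually_le_nhds (lt_add_one ‖amp‖))
  exact eventually_atTop.1 h

lemma integrand_bound {k A B R : ℝ} {ρ C : ℝ} (hk : 0 < k) (hR : 0 < R) (hA : R / 2 ≤ A)
    (hB : R / 2 ≤ B) (hρ : ∀ r, ρ ≤ r → ‖hsc r‖ ≤ C) (hRρ : ρ ≤ k * (R / 2)) :
    ‖integrandForm k A B R‖ ≤ (1 / 16) * (C * C) * (1 / (k / 2)) := by
  have hs : ∀ D, R / 2 ≤ D → √(k / 2) ≤ √(k * (D / R)) := by
    intro D hD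
    apply Real.sqrt_le_sqrt
    have : 1 / 2 ≤ D / R := by rw [le_div_iff₀ hR]; linarith
    nlinarith
  have hh1 : ∀ D, R / 2 ≤ D → ‖hsc (k * D)‖ ≤ C := fun D hD =>
    hρ _ (hRρ.trans (by gcongr))
  have hC : 0 ≤ C := (norm_nonneg _).trans (hh1 A hA)
  unfold integrandForm
  rw [norm_mul, norm_mul, norm_mul, norm_mul, mul_comm Complex.I, Complex.norm_exp_ofReal_mul_I,
    mul_one, Complex.norm_conj, Complex.norm_real]
  have h16 : ‖(1 / 16 : ℂ)‖ = 1 / 16 := by norm_num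
  rw [h16, Real.norm_of_nonneg (by positivity)]
  have hk2 : k / 2 = √(k / 2) * √(k / 2) := (Real.mul_self_sqrt (by positivity)).symm
  have hpos : 0 < √(k / 2) := by positivity
  rw [hk2]
  have := hh1 A hA
  have := hh1 B hB
  have := hs A hA
  have := hs B hB
  gcongr

lemma circle_cont (R : ℝ) : Continuous (circlePt R) := by
  unfold circlePt
  refine (EuclideanSpace.equiv (Fin 2) ℝ).symm.continuous.comp ?_
  refine continuous_pi (fun i => ?_)
  fin_cases i <;> simp <;> fun_prop

lemma gamma_cont {k R : ℝ} (hk : 0 < k) (y : EuclideanSpace ℝ (Fin 2)) (hR : 0 < R)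
    (h : 2 * ‖y‖ ≤ R) : Continuous (fun θ => gammaK k (circlePt R θ - y)) := by
  unfold gammaK
  refine continuous_const.mul (hankel_cont.comp_continuous ?_ ?_)
  · exact continuous_const.mul ((circle_cont R).sub continuous_const).norm
  · intro θ
    have := dist_lower θ y hR h
    exact mul_pos hk (by linarith)


/-- Helmholtz–Kirchhoff identity in two dimensions: for fixed `y, z ∈ ℝ²` and `k > 0`,
`∫_{∂B_R} conj(Γ^k(x,y)) Γ^k(x,z) dσ(x) → -(1/k) Im Γ^k(y,z)` as `R → ∞`, where the boundary
integral is computed in the arclength parametrisation `x = (R cos θ, R sin θ)`. -/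
theorem helmholtz_kirchhoff (k : ℝ) (hk : 0 < k) (y z : EuclideanSpace ℝ (Fin 2)) :
    Tendsto
      (fun R : ℝ => ∫ θ in (0 : ℝ)..(2 * Real.pi),
        (starRingEnd ℂ) (gammaK k (circlePt R θ - y)) * gammaK k (circlePt R θ - z) * (R : ℂ))
      atTop (nhds ((-(1 / k) * (gammaK k (y - z)).im : ℝ) : ℂ)) := by
  obtain ⟨ρ, hρ⟩ := hsc_bdd
  have key := intervalIntegral.tendsto_integral_filter_of_dominated_convergence (μ := volume)
    (a := 0) (b := 2 * Real.pi) (l := atTop)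
    (F := fun (R θ : ℝ) => (starRingEnd ℂ) (gammaK k (circlePt R θ - y)) *
      gammaK k (circlePt R θ - z) * (R : ℂ))
    (f := fun θ => ((1 / (8 * Real.pi * k) : ℝ) : ℂ) *
        Complex.exp (Complex.I * ((k * inner ℝ (circlePt 1 θ) (y - z) : ℝ) : ℂ)))
    (fun _ => (1 / 16) * ((‖amp‖ + 1) * (‖amp‖ + 1)) * (1 / (k / 2))) ?_ ?_ ?_ ?_
  · rw [intervalIntegral.integral_const_mul, circle_int] at key
    have e : ((-(1 / k) * (gammaK k (y - z)).im : ℝ) : ℂ) = ((1 / (8 * Real.pi * k) : ℝ) : ℂ) *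
        ((2 * Real.pi * besselJ0 (k * ‖y - z‖) : ℝ) : ℂ) := by
      have him : (gammaK k (y - z)).im = -(besselJ0 (k * ‖y - z‖)) / 4 := by
        have e1 : gammaK k (y - z) = ((besselY0 (k * ‖y - z‖) / 4 : ℝ) : ℂ) +
            ((-(besselJ0 (k * ‖y - z‖)) / 4 : ℝ) : ℂ) * Complex.I := by
          unfold gammaK hankelH10
          push_cast
          linear_combination (-(besselY0 (k * ‖y - z‖) : ℂ) / 4) * Complex.I_sq
        rw [e1, Complex.add_im, Complex.ofReal_im, Complex.im_ofReal_mul, Complex.I_im]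
        ring
      rw [him, ← Complex.ofReal_mul]
      congr 1
      have := Real.pi_ne_zero
      field_simp
      ring
    rw [e]
    exact key
  · filter_upwards [eventually_gt_atTop 0, eventually_ge_atTop (2 * ‖y‖),
      eventually_ge_atTop (2 * ‖z‖)] with R h0 hy hz
    refine Continuous.aestronglyMeasurable ?_
    exact ((Complex.continuous_conj.comp (gamma_cont hk y h0 hy)).mul
      (gamma_cont hk z h0 hz)).mul continuous_const
  · filter_upwards [eventually_gt_atTop 0, eventually_ge_atTop (2 * ‖y‖),
      eventually_ge_atTop (2 * ‖z‖), eventually_ge_atTop (2 * ρ / k)] with R h0 hy hz hr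
    filter_upwards with θ _
    have hA := dist_lower θ y h0 hy
    have hB := dist_lower θ z h0 hz
    rw [integrand_eq hk h0 _ _ (by linarith) (by linarith)]
    refine integrand_bound hk h0 hA hB hρ ?_
    rw [div_le_iff₀ hk] at hr
    linarith
  · exact intervalIntegrable_const
  · filter_upwards with θ _
    refine (integrand_lim hk y z θ).congr' ?_
    filter_upwards [eventually_gt_atTop 0, eventually_ge_atTop (2 * ‖y‖),
      eventually_ge_atTop (2 * ‖z‖)] with R h0 hy hz
    have hA := dist_lower θ y h0 hy
    have hB := dist_lower θ z h0 hz
    rw [integrand_eq hk h0 _ _ (by linarith) (by linarith)]
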